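/- arXiv:2501.16849 — 5 statements merged into one kernel-verified Lean document; each statement's English description precedes it below -/
import Mathlib

section
/- Let I ⊆ ℂ[x,y] be an ideal whose radical is the maximal ideal (x,y), with dim_ℂ ℂ[x,y]/I = 4, and such that for every pair (a,b) ∈ ℂ² with (a,b) ≠ (0,0) one has dim_ℂ ℂ[x,y]/(I + (ax+by)) = 2. Then there exist two linearly independent linear forms L₁, L₂ ∈ span_ℂ{x,y} such that I = (L₁², L₂²). -/
open MvPolynomial

namespace MvPolynomial

theorem mk_C_mul {σ K : Type*} [CommRing K] (J : Ideal (MvPolynomial σ K)) (a : K)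
    (f : MvPolynomial σ K) : Ideal.Quotient.mk J (C a * f) = a • Ideal.Quotient.mk J f := by
  rw [← smul_eq_C_mul]
  rfl

/-- Taylor expansion of a polynomial in two variables, to second order. -/
theorem exists_eq_affine_add_quadratic {K : Type*} [CommRing K] (f : MvPolynomial (Fin 2) K) :
    ∃ (a b c : K) (p q r : MvPolynomial (Fin 2) K),
      f = C a + C b * X 0 + C c * X 1 + p * X 0 ^ 2 + q * (X 0 * X 1) + r * X 1 ^ 2 := by
  induction f using MvPolynomial.induction_on with
  | C a => exact ⟨a, 0, 0, 0, 0, 0, by simp⟩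
  | add f g hf hg =>
    obtain ⟨a, b, c, p, q, r, hf⟩ := hf
    obtain ⟨a', b', c', p', q', r', hg⟩ := hg
    refine ⟨a + a', b + b', c + c', p + p', q + q', r + r', ?_⟩
    rw [hf, hg]
    simp only [C_add]
    ring
  | mul_X f i hf =>
    obtain ⟨a, b, c, p, q, r, hf⟩ := hf
    fin_cases i
    · refine ⟨0, a, 0, C b + p * X 0 + q * X 1, C c + r * X 1, 0, ?_⟩
      rw [hf]
      simp only [C_0, Fin.zero_eta]
      ring
    · refine ⟨0, 0, a, 0, C b + p * X 0, C c + q * X 0 + r * X 1, ?_⟩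
      rw [hf]
      simp only [C_0, Fin.mk_one]
      ring

/-- The `1`-jet at the origin of a polynomial in two variables. -/
noncomputable def oneJet (K : Type*) [CommRing K] : MvPolynomial (Fin 2) K →ₗ[K] Fin 3 → K :=
  LinearMap.pi ![lcoeff K 0, lcoeff K 0 ∘ₗ (pderiv 0).toLinearMap,
    lcoeff K 0 ∘ₗ (pderiv 1).toLinearMap]

theorem oneJet_apply {K : Type*} [CommRing K] (f : MvPolynomial (Fin 2) K) :
    oneJet K f = ![constantCoeff f, constantCoeff (pderiv 0 f), constantCoeff (pderiv 1 f)] := by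
  ext i
  fin_cases i <;> simp [oneJet, constantCoeff_eq]

theorem oneJet_affine_add_quadratic {K : Type*} [CommRing K] (a b c : K)
    (p q r : MvPolynomial (Fin 2) K) :
    oneJet K (C a + C b * X 0 + C c * X 1 + p * X 0 ^ 2 + q * (X 0 * X 1) + r * X 1 ^ 2) =
      ![a, b, c] := by
  rw [oneJet_apply]
  simp [pderiv_X]

/-- A quotient in which both variables vanish is spanned by `1`. -/
theorem finrank_quotient_le_one {K : Type*} [Field K] {J : Ideal (MvPolynomial (Fin 2) K)}
    (h0 : X 0 ∈ J) (h1 : X 1 ∈ J) : Module.finrank K (MvPolynomial (Fin 2) K ⧸ J) ≤ 1 := by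
  refine finrank_le_one 1 fun w ↦ ?_
  obtain ⟨f, rfl⟩ := Ideal.Quotient.mk_surjective w
  obtain ⟨a, b, c, p, q, r, hf⟩ := exists_eq_affine_add_quadratic f
  refine ⟨a, ?_⟩
  rw [← Ideal.Quotient.eq_zero_iff_mem] at h0 h1
  rw [hf, ← map_one (Ideal.Quotient.mk J), ← mk_C_mul]
  simp [h0, h1]

/-- If `x` is nilpotent modulo `J` and `u` is a unit, then `u + p x` is a unit modulo `J`, so
`x (u + p x) ∈ J` forces `x ∈ J`. -/
theorem mem_of_mul_add_mem {R : Type*} [CommRing R] {J : Ideal R} {x u p : R} (hu : IsUnit u)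
    (hx : x ∈ J.radical) (h : x * (u + p * x) ∈ J) : x ∈ J := by
  rw [← Ideal.Quotient.eq_zero_iff_mem] at h ⊢
  obtain ⟨n, hn⟩ := hx
  have hnil : IsNilpotent (Ideal.Quotient.mk J x) :=
    ⟨n, by rw [← map_pow, Ideal.Quotient.eq_zero_iff_mem]; exact hn⟩
  have hunit : IsUnit (Ideal.Quotient.mk J u + Ideal.Quotient.mk J (p * x)) := by
    rw [map_mul]
    exact ((Commute.all _ _).isNilpotent_mul_left hnil).isUnit_add_left_of_commute
      (hu.map _) (Commute.all _ _)
  rw [map_mul, map_add] at h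
  exact (hunit.mul_left_eq_zero).mp h

/-- If `L₁² = L₂² = 0` in a quotient and the variables are combinations of `L₁, L₂`, then
`1, L₁, L₂, L₁L₂` span the quotient. -/
theorem finite_and_finrank_quotient_le_four_of_sq_mem {K : Type*} [Field K]
    {J : Ideal (MvPolynomial (Fin 2) K)}
    {L₁ L₂ : MvPolynomial (Fin 2) K} (h₁ : L₁ ^ 2 ∈ J) (h₂ : L₂ ^ 2 ∈ J)
    (hX : ∀ i, ∃ s t : K, X i = C s * L₁ + C t * L₂) :
    Module.Finite K (MvPolynomial (Fin 2) K ⧸ J) ∧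
      Module.finrank K (MvPolynomial (Fin 2) K ⧸ J) ≤ 4 := by
  let v : Fin 4 → MvPolynomial (Fin 2) K ⧸ J :=
    ![1, Ideal.Quotient.mk J L₁, Ideal.Quotient.mk J L₂, Ideal.Quotient.mk J (L₁ * L₂)]
  have key : Function.Surjective (Fintype.linearCombination K v) := by
    intro w
    obtain ⟨f, rfl⟩ := Ideal.Quotient.mk_surjective w
    suffices ∃ a b c d : K, f - (C a + C b * L₁ + C c * L₂ + C d * (L₁ * L₂)) ∈ J by
      obtain ⟨a, b, c, d, h⟩ := this
      refine ⟨![a, b, c, d], ?_⟩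
      rw [← Ideal.Quotient.eq] at h
      rw [h, ← mul_one (C a), map_add, map_add, map_add]
      simp only [mk_C_mul]
      simp [Fintype.linearCombination_apply, Fin.sum_univ_four, v]
    induction f using MvPolynomial.induction_on with
    | C a => exact ⟨a, 0, 0, 0, by simp⟩
    | add f g hf hg =>
      obtain ⟨a, b, c, d, hf⟩ := hf
      obtain ⟨a', b', c', d', hg⟩ := hg
      refine ⟨a + a', b + b', c + c', d + d', ?_⟩
      convert J.add_mem hf hg using 1
      simp only [C_add]
      ring
    | mul_X f i hf =>
      obtain ⟨a, b, c, d, hf⟩ := hf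
      obtain ⟨s, t, hi⟩ := hX i
      refine ⟨0, a * s, a * t, b * t + c * s, ?_⟩
      convert J.add_mem (J.mul_mem_right (X i) hf)
        (J.add_mem (J.mul_mem_left (C s * C b + C s * C d * L₂) h₁)
          (J.mul_mem_left (C t * C c + C t * C d * L₁) h₂)) using 1
      rw [hi]
      simp only [C_add, C_mul, C_0]
      ring
  refine ⟨Module.Finite.of_surjective _ key, ?_⟩
  simpa using LinearMap.finrank_le_finrank_of_surjective key

end MvPolynomial

/-- A complex binary quadratic form of nonzero discriminant has two distinct zeros on the
projective line. -/
theorem exists_two_isotropic {α β γ : ℂ} (h : β ^ 2 ≠ α * γ) :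
    ∃ u v u' v' : ℂ, u * v' - u' * v ≠ 0 ∧
      u ^ 2 * α + 2 * (u * v) * β + v ^ 2 * γ = 0 ∧
      u' ^ 2 * α + 2 * (u' * v') * β + v' ^ 2 * γ = 0 := by
  by_cases hα : α = 0
  · subst hα
    have hβ : β ≠ 0 := by rintro rfl; simp at h
    exact ⟨1, 0, γ, -2 * β, by simpa using hβ, by ring, by ring⟩
  · obtain ⟨δ, hδ⟩ := IsAlgClosed.exists_eq_mul_self (β ^ 2 - α * γ)
    have hδ0 : δ ≠ 0 := by
      rintro rfl
      exact h (by linear_combination hδ)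
    refine ⟨-β + δ, α, -β - δ, α, ?_, ?_, ?_⟩
    · have : (-β + δ) * α - (-β - δ) * α = 2 * (δ * α) := by ring
      rw [this]
      simp [hδ0, hα]
    · linear_combination -α * hδ
    · linear_combination -α * hδ

/-- A degenerate binary quadratic form has a nonzero vector in its kernel. -/
theorem exists_kernel_of_degenerate {K : Type*} [Field K] {α β γ : K} (h : β ^ 2 = α * γ) :
    ∃ c d : K, ¬ (c = 0 ∧ d = 0) ∧ c * α + d * β = 0 ∧ c * β + d * γ = 0 := by
  by_cases hα : α = 0
  · subst hα
    have hβ : β = 0 := by simpa using h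
    exact ⟨1, 0, by simp, by simp, by simp [hβ]⟩
  · exact ⟨β, -α, by simp [hα], by ring, by linear_combination h⟩

namespace MvPolynomial

/-- An ideal supported at the origin whose sections by the coordinate axes are both
non-reduced consists of polynomials with vanishing `1`-jet. -/
theorem oneJet_eq_zero_of_mem {K : Type*} [Field K] {I : Ideal (MvPolynomial (Fin 2) K)}
    (hrad : I.radical = Ideal.span {X 0, X 1})
    (h0 : 1 < Module.finrank K (MvPolynomial (Fin 2) K ⧸ (I ⊔ Ideal.span {X 0})))
    (h1 : 1 < Module.finrank K (MvPolynomial (Fin 2) K ⧸ (I ⊔ Ideal.span {X 1})))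
    {f : MvPolynomial (Fin 2) K} (hf : f ∈ I) : oneJet K f = 0 := by
  obtain ⟨a, b, c, p, q, r, rfl⟩ := exists_eq_affine_add_quadratic f
  rw [oneJet_affine_add_quadratic]
  have hX (i : Fin 2) : (X i : MvPolynomial (Fin 2) K) ∈ I.radical := by
    rw [hrad]
    exact Ideal.subset_span (by fin_cases i <;> simp)
  have hm : I ≤ RingHom.ker (constantCoeff (R := K) (σ := Fin 2)) := by
    refine Ideal.le_radical.trans (hrad.le.trans ?_)
    rw [Ideal.span_le]
    rintro _ (rfl | rfl) <;> simp
  obtain rfl : a = 0 := by simpa using hm hf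
  have hb : b = 0 := by
    by_contra hb
    have hY : (X 1 : MvPolynomial (Fin 2) K) ∈ I ⊔ Ideal.span {X 1} :=
      Ideal.mem_sup_right (Ideal.mem_span_singleton_self _)
    refine h1.not_ge (finrank_quotient_le_one ?_ hY)
    refine mem_of_mul_add_mem (u := C b) (p := p) ((isUnit_iff_ne_zero.mpr hb).map C)
      (Ideal.radical_mono le_sup_left (hX 0)) ?_
    convert sub_mem (Ideal.mem_sup_left hf) (Ideal.mul_mem_left _ (C c + q * X 0 + r * X 1) hY)
      using 1
    rw [C_0]
    ring
  have hc : c = 0 := by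
    by_contra hc
    have hY : (X 0 : MvPolynomial (Fin 2) K) ∈ I ⊔ Ideal.span {X 0} :=
      Ideal.mem_sup_right (Ideal.mem_span_singleton_self _)
    refine h0.not_ge (finrank_quotient_le_one hY ?_)
    refine mem_of_mul_add_mem (u := C c) (p := r) ((isUnit_iff_ne_zero.mpr hc).map C)
      (Ideal.radical_mono le_sup_left (hX 1)) ?_
    convert sub_mem (Ideal.mem_sup_left hf) (Ideal.mul_mem_left _ (C b + q * X 1 + p * X 0) hY)
      using 1
    rw [C_0]
    ring
  ext i
  fin_cases i <;> simp [hb, hc]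

/-- In a length four quotient in which `1, X, Y` stay independent modulo elements of vanishing
`1`-jet, the quadratic monomials are proportional to a single element. -/
theorem exists_monomials_eq_smul {K : Type*} [Field K] {I : Ideal (MvPolynomial (Fin 2) K)}
    (hlen : Module.finrank K (MvPolynomial (Fin 2) K ⧸ I) = 4)
    (hjet : ∀ f ∈ I, oneJet K f = 0) :
    ∃ (s : MvPolynomial (Fin 2) K) (α β γ : K),
      X 0 ^ 2 - C α * s ∈ I ∧ X 0 * X 1 - C β * s ∈ I ∧ X 1 ^ 2 - C γ * s ∈ I := by
  have : Module.Finite K (MvPolynomial (Fin 2) K ⧸ I) :=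
    Module.finite_of_finrank_pos (by omega)
  let φ : (MvPolynomial (Fin 2) K ⧸ I) →ₗ[K] Fin 3 → K :=
    (I.restrictScalars K).liftQ (oneJet K) hjet
  have hφ (f : MvPolynomial (Fin 2) K) : φ (Ideal.Quotient.mk I f) = oneJet K f := rfl
  have hsurj : Function.Surjective φ := by
    intro w
    refine ⟨Ideal.Quotient.mk I (C (w 0) + C (w 1) * X 0 + C (w 2) * X 1 + 0 * X 0 ^ 2 +
      0 * (X 0 * X 1) + 0 * X 1 ^ 2), ?_⟩
    rw [hφ, oneJet_affine_add_quadratic]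
    ext i
    fin_cases i <;> rfl
  have hker : Module.finrank K (LinearMap.ker φ) = 1 := by
    have := φ.finrank_range_add_finrank_ker
    rw [LinearMap.range_eq_top.mpr hsurj, finrank_top, hlen] at this
    simp at this
    omega
  obtain ⟨⟨s, hs⟩, -, hspan⟩ := finrank_eq_one_iff'.mp hker
  obtain ⟨s, rfl⟩ := Ideal.Quotient.mk_surjective s
  have key (g : MvPolynomial (Fin 2) K) (hg : oneJet K g = 0) : ∃ a : K, g - C a * s ∈ I := by
    obtain ⟨a, ha⟩ := hspan ⟨Ideal.Quotient.mk I g, by rw [LinearMap.mem_ker, hφ, hg]⟩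
    refine ⟨a, ?_⟩
    rw [← Ideal.Quotient.eq, mk_C_mul]
    exact (Subtype.ext_iff.mp ha).symm
  obtain ⟨α, hα⟩ := key (X 0 ^ 2) (by
    rw [oneJet_apply]; ext i; fin_cases i <;> simp [pderiv_X])
  obtain ⟨β, hβ⟩ := key (X 0 * X 1) (by
    rw [oneJet_apply]; ext i; fin_cases i <;> simp [pderiv_X])
  obtain ⟨γ, hγ⟩ := key (X 1 ^ 2) (by
    rw [oneJet_apply]; ext i; fin_cases i <;> simp [pderiv_X])
  exact ⟨s, α, β, γ, hα, hβ, hγ⟩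

/-- Cutting a quotient by an element killed by both variables drops the dimension by at most
one. -/
theorem finrank_quotient_le_of_mul_mem {K : Type*} [Field K] {I : Ideal (MvPolynomial (Fin 2) K)}
    [Module.Finite K (MvPolynomial (Fin 2) K ⧸ I)] {l : MvPolynomial (Fin 2) K}
    (hl : ∀ i, X i * l ∈ I) :
    Module.finrank K (MvPolynomial (Fin 2) K ⧸ I) ≤
      Module.finrank K (MvPolynomial (Fin 2) K ⧸ (I ⊔ Ideal.span {l})) + 1 := by
  let ψ := (Ideal.Quotient.factorₐ K (le_sup_left : I ≤ I ⊔ Ideal.span {l})).toLinearMap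
  have hsurj : Function.Surjective ψ := Ideal.Quotient.factor_surjective le_sup_left
  have hrank := ψ.finrank_range_add_finrank_ker
  rw [LinearMap.range_eq_top.mpr hsurj, finrank_top] at hrank
  have hψ (f : MvPolynomial (Fin 2) K) :
      ψ (Ideal.Quotient.mk I f) = Ideal.Quotient.mk (I ⊔ Ideal.span {l}) f := rfl
  have hker : Module.finrank K (LinearMap.ker ψ) ≤ 1 := by
    refine finrank_le_one ⟨Ideal.Quotient.mk I l, ?_⟩ ?_
    · rw [LinearMap.mem_ker, hψ, Ideal.Quotient.eq_zero_iff_mem]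
      exact Ideal.mem_sup_right (Ideal.mem_span_singleton_self _)
    · rintro ⟨w, hw⟩
      obtain ⟨f, rfl⟩ := Ideal.Quotient.mk_surjective w
      rw [LinearMap.mem_ker, hψ, Ideal.Quotient.eq_zero_iff_mem, sup_comm,
        Ideal.mem_span_singleton_sup] at hw
      obtain ⟨g, e, he, rfl⟩ := hw
      obtain ⟨a, b, c, p, q, r, rfl⟩ := exists_eq_affine_add_quadratic g
      refine ⟨a, Subtype.ext ?_⟩
      change a • Ideal.Quotient.mk I l = _
      rw [← mk_C_mul, eq_comm, Ideal.Quotient.eq]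
      convert I.add_mem (I.add_mem (I.mul_mem_left (C b + p * X 0 + q * X 1) (hl 0))
        (I.mul_mem_left (C c + r * X 1) (hl 1))) he using 1
      ring
  omega

end MvPolynomial

/-- Every 2-superfat point of the plane supported at the origin (a local
0-dimensional scheme of length 4 whose intersection with every line through the
origin has length 2) is defined by an ideal of the form `(L₁², L₂²)` with
`L₁, L₂` independent linear forms. -/
theorem stmt_0 (I : Ideal (MvPolynomial (Fin 2) ℂ))
    (hrad : I.radical = Ideal.span {X 0, X 1})
    (hlen : Module.finrank ℂ (MvPolynomial (Fin 2) ℂ ⧸ I) = 4)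
    (hlines : ∀ a b : ℂ, ¬ (a = 0 ∧ b = 0) →
      Module.finrank ℂ
        (MvPolynomial (Fin 2) ℂ ⧸ (I ⊔ Ideal.span {C a * X 0 + C b * X 1})) = 2) :
    ∃ L₁ L₂ : MvPolynomial (Fin 2) ℂ,
      L₁ ∈ Submodule.span ℂ ({X 0, X 1} : Set (MvPolynomial (Fin 2) ℂ)) ∧
      L₂ ∈ Submodule.span ℂ ({X 0, X 1} : Set (MvPolynomial (Fin 2) ℂ)) ∧
      LinearIndependent ℂ ![L₁, L₂] ∧
      I = Ideal.span {L₁ ^ 2, L₂ ^ 2} := by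
  have hfin : Module.Finite ℂ (MvPolynomial (Fin 2) ℂ ⧸ I) :=
    Module.finite_of_finrank_pos (by omega)
  have hx := one_lt_two.trans_eq (hlines 1 0 (by simp)).symm
  have hy := one_lt_two.trans_eq (hlines 0 1 (by simp)).symm
  rw [show C 1 * X 0 + C 0 * X 1 = (X 0 : MvPolynomial (Fin 2) ℂ) by simp] at hx
  rw [show C 0 * X 0 + C 1 * X 1 = (X 1 : MvPolynomial (Fin 2) ℂ) by simp] at hy
  have hjet : ∀ f ∈ I, oneJet ℂ f = 0 := fun f hf ↦
    oneJet_eq_zero_of_mem hrad hx hy hf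
  obtain ⟨s, α, β, γ, hα, hβ, hγ⟩ := exists_monomials_eq_smul hlen hjet
  have hnondeg : β ^ 2 ≠ α * γ := by
    intro h
    obtain ⟨c, d, hcd, h₁, h₂⟩ := exists_kernel_of_degenerate h
    replace h₁ := congrArg (C (σ := Fin 2)) h₁
    replace h₂ := congrArg (C (σ := Fin 2)) h₂
    simp only [C_add, C_mul, C_0] at h₁ h₂
    have := finrank_quotient_le_of_mul_mem (I := I) (l := C c * X 0 + C d * X 1) fun i ↦ by
      fin_cases i
      · convert I.add_mem (I.mul_mem_left (C c) hα) (I.mul_mem_left (C d) hβ) using 1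
        simp only [Fin.zero_eta]
        linear_combination s * h₁
      · convert I.add_mem (I.mul_mem_left (C c) hβ) (I.mul_mem_left (C d) hγ) using 1
        simp only [Fin.mk_one]
        linear_combination s * h₂
    rw [hlines c d hcd, hlen] at this
    omega
  obtain ⟨u, v, u', v', hD, h₁, h₂⟩ := exists_two_isotropic hnondeg
  have hsq {u v : ℂ} (h : u ^ 2 * α + 2 * (u * v) * β + v ^ 2 * γ = 0) :
      (C u * X 0 + C v * X 1) ^ 2 ∈ I := by
    replace h := congrArg (C (σ := Fin 2)) h
    simp only [C_add, C_mul, C_pow, C_0] at h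
    convert I.add_mem (I.add_mem (I.mul_mem_left (C u ^ 2) hα)
      (I.mul_mem_left (C 2 * (C u * C v)) hβ)) (I.mul_mem_left (C v ^ 2) hγ) using 1
    have h2 : (C 2 : MvPolynomial (Fin 2) ℂ) = 2 := map_ofNat C 2
    rw [h2] at h ⊢
    linear_combination s * h
  refine ⟨C u * X 0 + C v * X 1, C u' * X 0 + C v' * X 1, ?_, ?_, ?_, ?_⟩
  · exact Submodule.mem_span_pair.mpr ⟨u, v, by simp [smul_eq_C_mul]⟩
  · exact Submodule.mem_span_pair.mpr ⟨u', v', by simp [smul_eq_C_mul]⟩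
  · rw [LinearIndependent.pair_iff]
    intro a b h
    have hx := congrArg (fun f ↦ constantCoeff (pderiv 0 f)) h
    have hy := congrArg (fun f ↦ constantCoeff (pderiv 1 f)) h
    simp [pderiv_X, smul_eq_C_mul] at hx hy
    constructor
    · refine (mul_eq_zero.mp ?_).resolve_right hD
      linear_combination v' * hx - u' * hy
    · refine (mul_eq_zero.mp ?_).resolve_right hD
      linear_combination u * hy - v * hx
  · set L₁ : MvPolynomial (Fin 2) ℂ := C u * X 0 + C v * X 1 with hL₁
    set L₂ : MvPolynomial (Fin 2) ℂ := C u' * X 0 + C v' * X 1 with hL₂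
    set J := Ideal.span {L₁ ^ 2, L₂ ^ 2} with hJ
    have hJI : J ≤ I := by
      rw [hJ, Ideal.span_le]
      rintro _ (rfl | rfl)
      exacts [hsq h₁, hsq h₂]
    have hDinv : (C (u * v' - u' * v)⁻¹ : MvPolynomial (Fin 2) ℂ) *
        (C u * C v' - C u' * C v) = 1 := by
      rw [← C_mul, ← C_mul, ← C_sub, ← C_mul, inv_mul_cancel₀ hD, C_1]
    obtain ⟨hJfin, hJrank⟩ := finite_and_finrank_quotient_le_four_of_sq_mem (J := J)
      (L₁ := L₁) (L₂ := L₂) (Ideal.subset_span (by simp))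
      (Ideal.subset_span (by simp)) fun i ↦ by
        fin_cases i
        · refine ⟨(u * v' - u' * v)⁻¹ * v', -((u * v' - u' * v)⁻¹ * v), ?_⟩
          simp only [C_mul, C_neg, hL₁, hL₂, Fin.zero_eta]
          linear_combination -X 0 * hDinv
        · refine ⟨-((u * v' - u' * v)⁻¹ * u'), (u * v' - u' * v)⁻¹ * u, ?_⟩
          simp only [C_mul, C_neg, hL₁, hL₂, Fin.mk_one]
          linear_combination -X 1 * hDinv
    let ψ := (Ideal.Quotient.factorₐ ℂ hJI).toLinearMap
    have hsurj : Function.Surjective ψ := Ideal.Quotient.factor_surjective hJI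
    have hle := LinearMap.finrank_le_finrank_of_surjective hsurj
    have hinj : Function.Injective ψ :=
      (LinearMap.injective_iff_surjective_of_finrank_eq_finrank (by omega)).mpr hsurj
    refine le_antisymm (fun f hf ↦ ?_) hJI
    rw [← Ideal.Quotient.eq_zero_iff_mem]
    apply hinj
    rw [map_zero]
    exact Ideal.Quotient.eq_zero_iff_mem.mpr hf
end

section
/- For all integers s ≥ 1 and d ≥ 1, there exist linear forms L_{i,1}, L_{i,2} ∈ ℂ[x,y,z] (1 ≤ i ≤ s), with L_{i,1}, L_{i,2} linearly independent for each i and with the s common zero points [L_{i,1}=L_{i,2}=0] ∈ ℙ² pairwise distinct, such that dim_ℂ ( ⋂_{i=1}^{s} (L_{i,1}², L_{i,2}²) )_d = max{0, (d+2)(d+1)/2 − 4s}. (This is the content of the statement that a general union of s 2-squares in ℙ² has good postulation, i.e. Hilbert function H(d) = min{ (d+2)(d+1)/2, 4s }; by semicontinuity, good postulation of a general union follows from the existence of one configuration attaining the expected dimension.) -/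
open MvPolynomial

/-- The dimension of the degree-`d` homogeneous part of a (homogeneous) ideal
`I ⊆ ℂ[x,y,z]`, as a `ℂ`-vector space. -/
noncomputable def hdim (I : Ideal (MvPolynomial (Fin 3) ℂ)) (d : ℕ) : ℕ :=
  Module.finrank ℂ
    ((Submodule.restrictScalars ℂ I ⊓ homogeneousSubmodule (Fin 3) ℂ d :
      Submodule ℂ (MvPolynomial (Fin 3) ℂ)))

namespace TwoSquare

/-- Ternary forms live in this polynomial ring. -/
abbrev TernaryRing := MvPolynomial (Fin 3) ℂ

section Curves

lemma derivative_aeval (g : Fin 3 → Polynomial ℂ) (f : TernaryRing) :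
    Polynomial.derivative (aeval g f) =
      ∑ i, aeval g (pderiv i f) * Polynomial.derivative (g i) := by
  induction f using MvPolynomial.induction_on with
  | C a => simp
  | add p q hp hq => simp [hp, hq, add_mul, Finset.sum_add_distrib]
  | mul_X p i hp =>
    simp only [map_mul, aeval_X, Polynomial.derivative_mul, hp, Derivation.leibniz, smul_eq_mul,
      map_add, add_mul, Finset.sum_add_distrib, pderiv_X]
    fin_cases i <;> simp [Fin.sum_univ_three, Pi.single_apply] <;> ring

lemma eval_aeval (g : Fin 3 → Polynomial ℂ) (t : ℂ) (f : TernaryRing) :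
    (aeval g f).eval t = eval (fun i => (g i).eval t) f := by
  induction f using MvPolynomial.induction_on with
  | C a => simp
  | add p q hp hq => simp [hp, hq]
  | mul_X p i hp => simp [hp]

/-- Restriction of a ternary form to the affine chart of the line `x = c z`. -/
noncomputable def restrict (c : ℂ) : TernaryRing →ₐ[ℂ] Polynomial ℂ :=
  aeval ![Polynomial.C c, Polynomial.X, 1]

lemma derivative_restrict (c : ℂ) (f : TernaryRing) :
    Polynomial.derivative (restrict c f) = restrict c (pderiv 1 f) := by
  simp [restrict, derivative_aeval, Fin.sum_univ_three]

lemma eval_restrict (c t : ℂ) (f : TernaryRing) :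
    (restrict c f).eval t = eval ![c, t, 1] f := by
  rw [restrict, eval_aeval]
  congr 2
  ext i
  fin_cases i <;> simp

lemma natDegree_restrict_le {d : ℕ} {f : TernaryRing} (hf : f.IsHomogeneous d) (c : ℂ) :
    (restrict c f).natDegree ≤ d := by
  have := MvPolynomial.aeval_natDegree_le f hf.totalDegree_le
    ![Polynomial.C c, Polynomial.X, 1] (n := 1) (by
      intro i
      fin_cases i <;> simp)
  simpa [restrict] using this

lemma sum_exponents_eq {d : ℕ} {f : TernaryRing} (hf : f.IsHomogeneous d) {m : Fin 3 →₀ ℕ}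
    (hm : m ∈ f.support) : m 0 + m 1 + m 2 = d := by
  by_contra h
  refine mem_support_iff.mp hm (hf.coeff_eq_zero ?_)
  rwa [Finsupp.degree_eq_sum, Fin.sum_univ_three]

lemma coeff_restrict {d : ℕ} {f : TernaryRing} (hf : f.IsHomogeneous d) (c : ℂ) :
    (restrict c f).coeff d = f.coeff (Finsupp.single 1 d) := by
  conv_lhs => rw [f.as_sum]
  simp only [map_sum, Polynomial.finsetSum_coeff]
  rw [Finset.sum_eq_single (Finsupp.single 1 d)]
  · simp [restrict, aeval_monomial]
  · intro m hm hne
    have hdeg := sum_exponents_eq hf hm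
    have h1 : m 1 ≠ d := by
      intro h
      apply hne
      ext i
      fin_cases i <;> simp <;> omega
    simp only [restrict, aeval_monomial]
    rw [Finsupp.prod_fintype _ _ (by simp)]
    simp only [Fin.prod_univ_three, Matrix.cons_val_zero, Matrix.cons_val_one,
      Matrix.cons_val, one_pow, mul_one, Polynomial.algebraMap_eq]
    rw [← mul_assoc, ← Polynomial.C_pow, ← Polynomial.C_mul, Polynomial.coeff_C_mul_X_pow]
    simp [Ne.symm h1]
  · intro h
    simp [notMem_support_iff.mp h]

lemma eval_smul_of_isHomogeneous {d : ℕ} {f : TernaryRing} (hf : f.IsHomogeneous d)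
    (r : ℂ) (v : Fin 3 → ℂ) : eval (r • v) f = r ^ d * eval v f := by
  conv_lhs => rw [f.as_sum]
  conv_rhs => rw [f.as_sum]
  simp only [map_sum, Finset.mul_sum]
  refine Finset.sum_congr rfl fun m hm => ?_
  have hdeg := sum_exponents_eq hf hm
  simp only [eval_monomial]
  rw [Finsupp.prod_fintype _ _ (by simp), Finsupp.prod_fintype _ _ (by simp)]
  simp only [Fin.prod_univ_three, Pi.smul_apply, smul_eq_mul, ← hdeg]
  ring

/-- A form vanishing identically on the chart `z = 1` is zero. -/
lemma eq_zero_of_eval_chart {d : ℕ} {f : TernaryRing} (hf : f.IsHomogeneous d)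
    (h : ∀ x y : ℂ, eval ![x, y, 1] f = 0) : f = 0 := by
  have h2 : f * X 2 = 0 := by
    apply MvPolynomial.funext
    intro v
    by_cases hz : v 2 = 0
    · simp [hz]
    · have hv : v = v 2 • ![v 0 / v 2, v 1 / v 2, 1] := by
        ext i
        fin_cases i <;> simp <;> field_simp
      rw [map_mul, hv, eval_smul_of_isHomogeneous hf, h]
      simp
  exact (mul_eq_zero.mp h2).resolve_right (X_ne_zero _)

/-- The linear form cutting out the line `x = c z`. -/
noncomputable def vline (c : ℂ) : TernaryRing := X 0 - C c * X 2

lemma isHomogeneous_vline (c : ℂ) : (vline c).IsHomogeneous 1 :=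
  (isHomogeneous_X _ _).sub (isHomogeneous_C_mul_X _ _)

lemma vline_ne_zero (c : ℂ) : vline c ≠ 0 := by
  intro h
  have := congrArg (eval ![1, 0, 0]) h
  simp [vline] at this

lemma vline_dvd_of_restrict_eq_zero {d : ℕ} {f : TernaryRing} (hf : f.IsHomogeneous d)
    {c : ℂ} (h : restrict c f = 0) : vline c ∣ f := by
  have key : ∀ f : TernaryRing, vline c ∣ f - aeval ![C c * X 2, X 1, X 2] f := by
    intro f
    induction f using MvPolynomial.induction_on with
    | C a => simp [algebraMap_eq]
    | add p q hp hq =>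
      rw [map_add, add_sub_add_comm]
      exact dvd_add hp hq
    | mul_X p i hp =>
      have hX : vline c ∣ X i - (![C c * X 2, X 1, X 2] : Fin 3 → TernaryRing) i := by
        fin_cases i <;> simp [vline]
      obtain ⟨a, ha⟩ := hp
      obtain ⟨b, hb⟩ := hX
      refine ⟨a * X i + aeval ![C c * X 2, X 1, X 2] p * b, ?_⟩
      rw [map_mul, aeval_X]
      linear_combination X i * ha + aeval ![C c * X 2, X 1, X 2] p * hb
  have hzero : aeval ![C c * X 2, X 1, X 2] f = (0 : TernaryRing) := by
    have hh : (aeval ![C c * X 2, X 1, X 2] f : TernaryRing).IsHomogeneous (1 * d) := by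
      apply hf.aeval
      intro i
      fin_cases i
      · exact isHomogeneous_C_mul_X _ _
      · exact isHomogeneous_X _ _
      · exact isHomogeneous_X _ _
    apply eq_zero_of_eval_chart hh
    intro x y
    have := congrArg (Polynomial.eval y) h
    rw [eval_restrict] at this
    rw [← aeval_eq_eval, ← AlgHom.comp_apply, comp_aeval]
    simp only [Polynomial.eval_zero] at this
    rw [← this, ← aeval_eq_eval]
    congr 2
    ext i
    fin_cases i <;> simp
  have := key f
  rwa [hzero, sub_zero] at this

lemma exists_isHomogeneous_of_vline_dvd {d : ℕ} {f : TernaryRing} (hf : f.IsHomogeneous (d + 1))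
    {c : ℂ} (h : vline c ∣ f) : ∃ g : TernaryRing, g.IsHomogeneous d ∧ f = vline c * g := by
  obtain ⟨g, hg⟩ := h
  let _ : GradedAlgebra (homogeneousSubmodule (Fin 3) ℂ) := gradedAlgebra
  refine ⟨DirectSum.decompose (homogeneousSubmodule (Fin 3) ℂ) g d,
    (mem_homogeneousSubmodule _ _).mp (DirectSum.decompose (homogeneousSubmodule (Fin 3) ℂ) g d).2,
    ?_⟩
  have h1 := DirectSum.coe_decompose_mul_add_of_left_mem (homogeneousSubmodule (Fin 3) ℂ)
    (i := 1) (j := d) (b := g) (isHomogeneous_vline c)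
  have h2 := DirectSum.decompose_of_mem_same (homogeneousSubmodule (Fin 3) ℂ) (x := f)
    (i := 1 + d) (by rw [add_comm]; exact hf)
  rwa [← hg, h2] at h1

lemma natDegree_restrict_pderiv_le {d : ℕ} {f : TernaryRing} (hf : f.IsHomogeneous (d + 1))
    (i : Fin 3) (c : ℂ) : (restrict c (pderiv i f)).natDegree ≤ d :=
  natDegree_restrict_le (by simpa using hf.pderiv (i := i)) c

lemma restrict_vline_mul_pderiv (c : ℂ) (g : TernaryRing) :
    restrict c (pderiv 0 (vline c * g)) = restrict c g := by
  simp [vline, restrict, pderiv_X, Derivation.leibniz]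

/-- A form vanishing to second order along the line `x = c z` is divisible by the square of
the equation of the line. -/
lemma exists_eq_vline_sq_mul {d : ℕ} {f : TernaryRing} (hf : f.IsHomogeneous (d + 2)) {c : ℂ}
    (h0 : restrict c f = 0) (h1 : restrict c (pderiv 0 f) = 0) :
    ∃ h : TernaryRing, h.IsHomogeneous d ∧ f = vline c ^ 2 * h := by
  obtain ⟨g, hg, rfl⟩ :=
    exists_isHomogeneous_of_vline_dvd hf (vline_dvd_of_restrict_eq_zero hf h0)
  rw [restrict_vline_mul_pderiv] at h1
  obtain ⟨h, hh, rfl⟩ :=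
    exists_isHomogeneous_of_vline_dvd hg (vline_dvd_of_restrict_eq_zero hg h1)
  exact ⟨h, hh, by ring⟩

end Curves

section Univariate

open Polynomial in
lemma eq_C_mul_of_mul_derivative_eq {f g : Polynomial ℂ} (hf : f ≠ 0)
    (h : f * derivative g = g * derivative f) : ∃ r : ℂ, g = Polynomial.C r * f := by
  obtain ⟨t, ht⟩ : ∃ t, f.eval t ≠ 0 := by
    by_contra! hall
    exact hf (Polynomial.funext fun t => by simpa using hall t)
  refine ⟨g.eval t / f.eval t, ?_⟩
  set k := g - Polynomial.C (g.eval t / f.eval t) * f with hk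
  have hkt : k.IsRoot t := by simp [hk, ht]
  have hkk : f * derivative k = k * derivative f := by
    simp only [hk, derivative_sub, derivative_mul, derivative_C, zero_mul, zero_add]
    linear_combination h
  by_contra hne
  have hk0 : k ≠ 0 := fun h0 => hne (sub_eq_zero.mp h0)
  have hk' : derivative k ≠ 0 := by
    intro h0
    obtain ⟨a, ha⟩ := natDegree_eq_zero.mp (Polynomial.derivative_eq_zero.mp h0)
    rw [← ha, IsRoot, Polynomial.eval_C] at hkt
    exact hk0 (by rw [← ha, hkt, Polynomial.C_0])
  have hmul := derivative_rootMultiplicity_of_root hkt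
  have hpos := (rootMultiplicity_pos hk0).mpr hkt
  have hl := rootMultiplicity_mul (x := t) (mul_ne_zero hf hk')
  have hfd : derivative f ≠ 0 := by
    intro h0
    rw [h0, mul_zero] at hkk
    exact (mul_ne_zero hf hk') hkk
  have hr := rootMultiplicity_mul (x := t) (mul_ne_zero hk0 hfd)
  rw [hkk, hr, rootMultiplicity_eq_zero ht] at hl
  omega

open Polynomial in
/-- At a general point, an `m`-dimensional space of univariate polynomials contains no nonzero
element vanishing to order `m`. -/
lemma exists_forall_pow_dvd_eq_zero (m : ℕ) :
    ∀ (W : Submodule ℂ (Polynomial ℂ)) [FiniteDimensional ℂ W], Module.finrank ℂ W ≤ m →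
      ∀ F : Set ℂ, F.Finite →
        ∃ t ∉ F, ∀ f ∈ W, (Polynomial.X - Polynomial.C t) ^ m ∣ f → f = 0 := by
  induction m with
  | zero =>
    intro W _ hW F hF
    obtain ⟨t, ht⟩ := hF.exists_notMem
    refine ⟨t, ht, fun f hf _ => ?_⟩
    have : W = ⊥ := Submodule.finrank_eq_zero.mp (Nat.le_zero.mp hW)
    simpa [this] using hf
  | succ m ih =>
    intro W _ hW F hF
    by_cases hbot : W = ⊥
    · obtain ⟨t, ht⟩ := hF.exists_notMem
      exact ⟨t, ht, fun f hf _ => by simpa [hbot] using hf⟩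
    obtain ⟨g, hgW, hg⟩ := Submodule.exists_mem_ne_zero_of_ne_bot hbot
    let φ : Polynomial ℂ →ₗ[ℂ] Polynomial ℂ :=
      LinearMap.mulLeft ℂ g ∘ₗ derivative - LinearMap.mulRight ℂ (derivative g)
    have hφ : ∀ f, φ f = g * derivative f - f * derivative g := fun f => rfl
    have hrank : Module.finrank ℂ (W.map φ) ≤ m := by
      have h1 := LinearMap.finrank_range_add_finrank_ker (φ.domRestrict W)
      rw [LinearMap.range_domRestrict] at h1
      have h2 : 0 < Module.finrank ℂ (LinearMap.ker (φ.domRestrict W)) := by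
        have hx : (⟨g, hgW⟩ : W) ∈ LinearMap.ker (φ.domRestrict W) := by
          rw [LinearMap.mem_ker, LinearMap.domRestrict_apply, hφ]
          ring
        have : Nontrivial (LinearMap.ker (φ.domRestrict W)) :=
          Submodule.nontrivial_iff_ne_bot.mpr
            (Submodule.ne_bot_iff _ |>.mpr ⟨_, hx, fun h0 => hg (congrArg Subtype.val h0)⟩)
        exact Module.finrank_pos (R := ℂ) (M := LinearMap.ker (φ.domRestrict W))
      omega
    obtain ⟨t, ht, hker⟩ := ih (W.map φ) hrank (F ∪ {t | g.IsRoot t})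
      (hF.union (finite_setOfPred_isRoot hg))
    simp only [Set.mem_union, not_or, Set.mem_ofPred_eq] at ht
    refine ⟨t, ht.1, fun f hfW hdvd => ?_⟩
    have h0 : φ f = 0 := by
      apply hker _ (Submodule.mem_map_of_mem hfW)
      rw [hφ]
      refine dvd_sub (Dvd.dvd.mul_left ?_ _) (Dvd.dvd.mul_right ?_ _)
      · simpa using pow_sub_one_dvd_derivative_of_pow_dvd hdvd
      · exact (pow_dvd_pow _ (Nat.le_succ m)).trans hdvd
    rw [hφ, sub_eq_zero] at h0
    obtain ⟨r, rfl⟩ := eq_C_mul_of_mul_derivative_eq hg h0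
    have hroot : (Polynomial.C r * g).IsRoot t :=
      dvd_iff_isRoot.mp ((dvd_pow_self _ (Nat.succ_ne_zero m)).trans hdvd)
    rw [IsRoot, Polynomial.eval_mul, Polynomial.eval_C, mul_eq_zero] at hroot
    rcases hroot with h | h
    · simp [h]
    · exact absurd h ht.2

open Polynomial in
lemma pow_dvd_of_iterate_derivative {p : Polynomial ℂ} {t : ℂ} {n : ℕ}
    (h : ∀ j < n, (derivative^[j] p).eval t = 0) : (Polynomial.X - Polynomial.C t) ^ n ∣ p := by
  rcases Nat.eq_zero_or_pos n with rfl | hn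
  · simp
  by_cases hp : p = 0
  · simp [hp]
  rw [← le_rootMultiplicity_iff hp]
  have := (lt_rootMultiplicity_iff_isRoot_iterate_derivative (n := n - 1) (t := t) hp).mpr
    fun m hm => h m (by omega)
  omega

open Polynomial in
lemma sq_dvd_of_eval {p : Polynomial ℂ} {t : ℂ} (h0 : p.eval t = 0)
    (h1 : (derivative p).eval t = 0) : (Polynomial.X - Polynomial.C t) ^ 2 ∣ p :=
  pow_dvd_of_iterate_derivative fun j hj => by
    interval_cases j
    · simpa using h0
    · simpa using h1

open Polynomial in
lemma cube_dvd_of_eval {p : Polynomial ℂ} {t : ℂ} (h0 : p.eval t = 0)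
    (h1 : (derivative p).eval t = 0) (h2 : (derivative (derivative p)).eval t = 0) :
    (Polynomial.X - Polynomial.C t) ^ 3 ∣ p :=
  pow_dvd_of_iterate_derivative fun j hj => by
    interval_cases j
    · simpa using h0
    · simpa using h1
    · simpa using h2

open Polynomial in
lemma eq_zero_of_pow_dvd_of_degree_lt {p : Polynomial ℂ} (s : Finset ℂ) (e : ℂ → ℕ)
    (hdvd : ∀ b ∈ s, (Polynomial.X - Polynomial.C b) ^ e b ∣ p) (hdeg : p.degree < ((∑ b ∈ s, e b : ℕ) : WithBot ℕ)) :
    p = 0 := by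
  have hprod : ∏ b ∈ s, (Polynomial.X - Polynomial.C b) ^ e b ∣ p :=
    Finset.prod_dvd_of_coprime
      (fun a _ b _ hab => (pairwise_coprime_X_sub_C Function.injective_id hab).pow) hdvd
  have hmonic : (∏ b ∈ s, (Polynomial.X - Polynomial.C b) ^ e b).Monic :=
    monic_prod_of_monic _ _ fun b _ => (monic_X_sub_C b).pow _
  refine eq_zero_of_dvd_of_degree_lt hprod ?_
  rw [degree_eq_natDegree hmonic.ne_zero, natDegree_prod_of_monic _ _ fun b _ => (monic_X_sub_C b).pow _]
  simpa using hdeg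

end Univariate

section Kronecker

/-- Restriction of a ternary form to the affine curve `x = t ^ M, y = t`. -/
noncomputable def kronecker (M : ℕ) : TernaryRing →ₐ[ℂ] Polynomial ℂ :=
  aeval ![Polynomial.X ^ M, Polynomial.X, 1]

lemma eval_kronecker (M : ℕ) (t : ℂ) (f : TernaryRing) :
    (kronecker M f).eval t = eval ![t ^ M, t, 1] f := by
  rw [kronecker, eval_aeval]
  congr 2
  ext i
  fin_cases i <;> simp

lemma derivative_kronecker (M : ℕ) (f : TernaryRing) :
    Polynomial.derivative (kronecker M f) =
      kronecker M (pderiv 0 f) * Polynomial.derivative (Polynomial.X ^ M) +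
        kronecker M (pderiv 1 f) := by
  simp [kronecker, derivative_aeval, Fin.sum_univ_three]

lemma eq_zero_of_kronecker_eq_zero {d : ℕ} {f : TernaryRing} (hf : f.IsHomogeneous d)
    (h : kronecker (d + 1) f = 0) : f = 0 := by
  by_contra hne
  obtain ⟨m, hm⟩ := support_nonempty.mpr hne
  have hdeg := sum_exponents_eq hf hm
  have hcoeff := congrArg (fun p => Polynomial.coeff p ((d + 1) * m 0 + m 1)) h
  have hmon : ∀ k : Fin 3 →₀ ℕ, kronecker (d + 1) (monomial k (coeff k f)) =
      Polynomial.C (coeff k f) * Polynomial.X ^ ((d + 1) * k 0 + k 1) := by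
    intro k
    simp only [kronecker, aeval_monomial]
    rw [Finsupp.prod_fintype _ _ (by simp)]
    simp only [Fin.prod_univ_three, Matrix.cons_val_zero, Matrix.cons_val_one,
      Matrix.cons_val, one_pow, mul_one, Polynomial.algebraMap_eq]
    ring
  rw [f.as_sum] at hcoeff
  simp only [map_sum, Polynomial.finsetSum_coeff, hmon, Polynomial.coeff_C_mul_X_pow,
    Polynomial.coeff_zero] at hcoeff
  rw [Finset.sum_eq_single m] at hcoeff
  · exact mem_support_iff.mp hm (by simpa using hcoeff)
  · intro k hk hkm
    rw [if_neg]
    intro heq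
    have hdegk := sum_exponents_eq hf hk
    have h1 : m 1 = k 1 := by
      have := congrArg (· % (d + 1)) heq
      simpa [Nat.mul_add_mod, Nat.mod_eq_of_lt (show m 1 < d + 1 by omega),
        Nat.mod_eq_of_lt (show k 1 < d + 1 by omega)] using this
    have h0 : m 0 = k 0 := by
      rw [h1] at heq
      exact Nat.eq_of_mul_eq_mul_left (Nat.succ_pos d) (Nat.add_right_cancel heq)
    apply hkm
    ext i
    fin_cases i
    · exact h0.symm
    · exact h1.symm
    · simp only [Fin.reduceFinMk]
      omega
  · intro h
    exact absurd hm h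

end Kronecker

section Squares

/-- A 2-square supported at the point `[a : b : 1]`, given by the two tangent directions
`u`, `v` on which the ideal is determined by the mixed second derivative. -/
structure Sq where
  a : ℂ
  b : ℂ
  u₁ : ℂ
  u₂ : ℂ
  v₁ : ℂ
  v₂ : ℂ
  det_ne_zero : u₁ * v₂ - u₂ * v₁ ≠ 0

namespace Sq

/-- The support, in the chart `z = 1`. -/
def point (q : Sq) : ℂ × ℂ := (q.a, q.b)

/-- Evaluation at the support of a 2-square. -/
noncomputable def evalAt (q : Sq) : TernaryRing →ₗ[ℂ] ℂ :=
  (aeval ![q.a, q.b, 1]).toLinearMap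

lemma evalAt_apply (q : Sq) (f : TernaryRing) : q.evalAt f = eval ![q.a, q.b, 1] f := by
  simp [evalAt, aeval_eq_eval]

/-- The four linear conditions a 2-square imposes on forms. -/
noncomputable def conditions (q : Sq) : TernaryRing →ₗ[ℂ] (Fin 4 → ℂ) :=
  LinearMap.pi ![q.evalAt, q.evalAt ∘ₗ (pderiv 0).toLinearMap, q.evalAt ∘ₗ (pderiv 1).toLinearMap,
    (q.u₁ * q.v₁) • (q.evalAt ∘ₗ (pderiv 0).toLinearMap ∘ₗ (pderiv 0).toLinearMap) +
    (q.u₁ * q.v₂ + q.u₂ * q.v₁) •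
      (q.evalAt ∘ₗ (pderiv 1).toLinearMap ∘ₗ (pderiv 0).toLinearMap) +
    (q.u₂ * q.v₂) • (q.evalAt ∘ₗ (pderiv 1).toLinearMap ∘ₗ (pderiv 1).toLinearMap)]

lemma conditions_eq_zero_iff (q : Sq) (f : TernaryRing) :
    q.conditions f = 0 ↔
      eval ![q.a, q.b, 1] f = 0 ∧ eval ![q.a, q.b, 1] (pderiv 0 f) = 0 ∧
      eval ![q.a, q.b, 1] (pderiv 1 f) = 0 ∧
      q.u₁ * q.v₁ * eval ![q.a, q.b, 1] (pderiv 0 (pderiv 0 f)) +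
        (q.u₁ * q.v₂ + q.u₂ * q.v₁) * eval ![q.a, q.b, 1] (pderiv 1 (pderiv 0 f)) +
        q.u₂ * q.v₂ * eval ![q.a, q.b, 1] (pderiv 1 (pderiv 1 f)) = 0 := by
  simp [funext_iff, Fin.forall_fin_succ, conditions, evalAt_apply]

/-- The linear form dual to the direction `u`. -/
noncomputable def form₁ (q : Sq) : TernaryRing :=
  C q.v₂ * (X 0 - C q.a * X 2) - C q.v₁ * (X 1 - C q.b * X 2)

/-- The linear form dual to the direction `v`. -/
noncomputable def form₂ (q : Sq) : TernaryRing :=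
  C q.u₁ * (X 1 - C q.b * X 2) - C q.u₂ * (X 0 - C q.a * X 2)

lemma isHomogeneous_form₁ (q : Sq) : q.form₁.IsHomogeneous 1 := by
  have h : ∀ (r s : ℂ) (i : Fin 3), (C r * (X i - C s * X 2) : TernaryRing).IsHomogeneous 1 :=
    fun r s i => by
      simpa using (isHomogeneous_C _ r).mul
        ((isHomogeneous_X ℂ i).sub (isHomogeneous_C_mul_X s (2 : Fin 3)))
  exact (h _ _ _).sub (h _ _ _)

lemma isHomogeneous_form₂ (q : Sq) : q.form₂.IsHomogeneous 1 := by
  have h : ∀ (r s : ℂ) (i : Fin 3), (C r * (X i - C s * X 2) : TernaryRing).IsHomogeneous 1 :=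
    fun r s i => by
      simpa using (isHomogeneous_C _ r).mul
        ((isHomogeneous_X ℂ i).sub (isHomogeneous_C_mul_X s (2 : Fin 3)))
  exact (h _ _ _).sub (h _ _ _)

/-- The ideal of a 2-square. -/
noncomputable def ideal (q : Sq) : Ideal TernaryRing := Ideal.span {q.form₁ ^ 2, q.form₂ ^ 2}

@[simp] lemma eval_form₁ (q : Sq) : eval ![q.a, q.b, 1] q.form₁ = 0 := by simp [form₁]

@[simp] lemma eval_form₂ (q : Sq) : eval ![q.a, q.b, 1] q.form₂ = 0 := by simp [form₂]

@[simp] lemma pderiv_zero_form₁ (q : Sq) : pderiv 0 q.form₁ = C q.v₂ := by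
  simp [form₁, pderiv_X, Derivation.leibniz]

@[simp] lemma pderiv_one_form₁ (q : Sq) : pderiv 1 q.form₁ = -C q.v₁ := by
  simp [form₁, pderiv_X, Derivation.leibniz]

@[simp] lemma pderiv_zero_form₂ (q : Sq) : pderiv 0 q.form₂ = -C q.u₂ := by
  simp [form₂, pderiv_X, Derivation.leibniz]

@[simp] lemma pderiv_one_form₂ (q : Sq) : pderiv 1 q.form₂ = C q.u₁ := by
  simp [form₂, pderiv_X, Derivation.leibniz]

lemma conditions_eq_zero_of_mem_ideal (q : Sq) {f : TernaryRing} (hf : f ∈ q.ideal) :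
    q.conditions f = 0 := by
  obtain ⟨r, s, rfl⟩ := Ideal.mem_span_pair.mp hf
  rw [map_add, conditions_eq_zero_iff _ _ |>.mpr, conditions_eq_zero_iff _ _ |>.mpr, add_zero]
  all_goals
    simp only [pow_two, Derivation.leibniz, smul_eq_mul, map_add, map_mul, map_neg, mul_zero,
      eval_form₁, eval_form₂, pderiv_zero_form₁, pderiv_one_form₁, pderiv_zero_form₂,
      pderiv_one_form₂, eval_C, pderiv_C, map_zero, zero_mul, add_zero, zero_add, true_and]
    ring

/-- Representatives of a basis of the degree `d` part of `ℂ[x,y,z]` modulo a 2-square. -/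
noncomputable def residue (q : Sq) (d : ℕ) (j : Fin 2 × Fin 2) : TernaryRing :=
  if (j.1 : ℕ) + j.2 ≤ d then X 2 ^ (d - (j.1 + j.2)) * (q.form₁ ^ (j.1 : ℕ) * q.form₂ ^ (j.2 : ℕ))
  else 0

/-- The forms of degree `d` which are a combination of residues modulo the ideal. -/
noncomputable def reducible (q : Sq) (d : ℕ) : Submodule ℂ TernaryRing :=
  q.ideal.restrictScalars ℂ ⊔ Submodule.span ℂ (Set.range (q.residue d))

lemma mul_mem_reducible (q : Sq) {d : ℕ} {f g : TernaryRing}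
    (hg : ∀ j, g * q.residue d j ∈ q.reducible (d + 1)) (hf : f ∈ q.reducible d) :
    g * f ∈ q.reducible (d + 1) := by
  have : q.reducible d ≤ (q.reducible (d + 1)).comap (LinearMap.mulLeft ℂ g) := by
    refine sup_le (fun f hf => ?_) (Submodule.span_le.mpr ?_)
    · exact Submodule.mem_sup_left (Ideal.mul_mem_left _ _ hf)
    · rintro _ ⟨j, rfl⟩
      exact hg j
  exact this hf

lemma residue_mem_reducible (q : Sq) (d : ℕ) (j : Fin 2 × Fin 2) :
    q.residue d j ∈ q.reducible d :=
  Submodule.mem_sup_right (Submodule.subset_span ⟨j, rfl⟩)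

lemma X_two_mul_mem_reducible (q : Sq) {d : ℕ} {f : TernaryRing} (hf : f ∈ q.reducible d) :
    X 2 * f ∈ q.reducible (d + 1) := by
  refine q.mul_mem_reducible (fun j => ?_) hf
  by_cases h : (j.1 : ℕ) + j.2 ≤ d
  · convert q.residue_mem_reducible (d + 1) j using 1
    rw [residue, residue, if_pos h, if_pos (by omega), Nat.sub_add_comm h, pow_succ]
    ring
  · simp [residue, h]

lemma sq_mul_mem_ideal_left (q : Sq) (g : TernaryRing) : g * q.form₁ ^ 2 ∈ q.ideal :=
  Ideal.mul_mem_left _ _ (Ideal.subset_span (by simp))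

lemma sq_mul_mem_ideal_right (q : Sq) (g : TernaryRing) : g * q.form₂ ^ 2 ∈ q.ideal :=
  Ideal.mul_mem_left _ _ (Ideal.subset_span (by simp))

lemma form₁_mul_mem_reducible (q : Sq) {d : ℕ} {f : TernaryRing} (hf : f ∈ q.reducible d) :
    q.form₁ * f ∈ q.reducible (d + 1) := by
  refine q.mul_mem_reducible (fun j => ?_) hf
  by_cases h : (j.1 : ℕ) + j.2 ≤ d
  swap
  · simp [residue, h]
  obtain ⟨j, k⟩ := j
  rw [residue, if_pos h]
  fin_cases j
  · convert q.residue_mem_reducible (d + 1) (1, k) using 1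
    simp only [zero_add] at h ⊢
    rw [residue, if_pos (by simp; omega)]
    rw [show d + 1 - (((1, k) : Fin 2 × Fin 2).1 + ((1, k) : Fin 2 × Fin 2).2 : ℕ) = d - k by
      simp; omega]
    simp
    ring_nf
  · refine Submodule.mem_sup_left ?_
    convert q.sq_mul_mem_ideal_left (X 2 ^ (d - (1 + k : ℕ)) * q.form₂ ^ (k : ℕ)) using 1
    simp
    ring_nf

lemma form₂_mul_mem_reducible (q : Sq) {d : ℕ} {f : TernaryRing} (hf : f ∈ q.reducible d) :
    q.form₂ * f ∈ q.reducible (d + 1) := by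
  refine q.mul_mem_reducible (fun j => ?_) hf
  by_cases h : (j.1 : ℕ) + j.2 ≤ d
  swap
  · simp [residue, h]
  obtain ⟨j, k⟩ := j
  rw [residue, if_pos h]
  fin_cases k
  · convert q.residue_mem_reducible (d + 1) (j, 1) using 1
    simp only [add_zero] at h ⊢
    rw [residue, if_pos (by simp; omega)]
    rw [show d + 1 - (((j, 1) : Fin 2 × Fin 2).1 + ((j, 1) : Fin 2 × Fin 2).2 : ℕ) = d - j by
      simp]
    simp
    ring_nf
  · refine Submodule.mem_sup_left ?_
    convert q.sq_mul_mem_ideal_right (X 2 ^ (d - (j + 1 : ℕ)) * q.form₁ ^ (j : ℕ)) using 1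
    simp
    ring_nf

lemma X_mul_mem_reducible (q : Sq) {d : ℕ} {f : TernaryRing} (hf : f ∈ q.reducible d)
    (i : Fin 3) : X i * f ∈ q.reducible (d + 1) := by
  have hΔ : (C (q.u₁ * q.v₂ - q.u₂ * q.v₁)⁻¹ : TernaryRing) *
      (C q.u₁ * C q.v₂ - C q.u₂ * C q.v₁) = 1 := by
    rw [← C_mul, ← C_mul, ← C_sub, ← C_mul, inv_mul_cancel₀ q.det_ne_zero, C_1]
  have h1 := q.form₁_mul_mem_reducible hf
  have h2 := q.form₂_mul_mem_reducible hf
  have h3 := q.X_two_mul_mem_reducible hf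
  set D := (q.u₁ * q.v₂ - q.u₂ * q.v₁)⁻¹
  have key : ∀ r s t : ℂ, C r * (q.form₁ * f) + C s * (q.form₂ * f) + C t * (X 2 * f) ∈
      q.reducible (d + 1) := by
    intro r s t
    simp only [C_mul']
    exact add_mem (add_mem (Submodule.smul_mem _ _ h1) (Submodule.smul_mem _ _ h2))
      (Submodule.smul_mem _ _ h3)
  fin_cases i
  · convert key (D * q.u₁) (D * q.v₁) q.a using 1
    simp only [form₁, form₂, C_mul, Fin.zero_eta]
    linear_combination (-(X 0 - C q.a * X 2) * f) * hΔ
  · convert key (D * q.u₂) (D * q.v₂) q.b using 1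
    simp only [form₁, form₂, C_mul, Fin.mk_one]
    linear_combination (-(X 1 - C q.b * X 2) * f) * hΔ
  · exact h3

lemma X_pow_mul_mem_reducible (q : Sq) {d : ℕ} {f : TernaryRing} (hf : f ∈ q.reducible d)
    (i : Fin 3) (n : ℕ) : X i ^ n * f ∈ q.reducible (d + n) := by
  induction n with
  | zero => simpa using hf
  | succ n ih =>
    rw [pow_succ', mul_assoc]
    exact q.X_mul_mem_reducible ih i

lemma mem_reducible (q : Sq) {d : ℕ} {f : TernaryRing} (hf : f.IsHomogeneous d) :
    f ∈ q.reducible d := by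
  rw [f.as_sum]
  refine Submodule.sum_mem _ fun m hm => ?_
  have hdeg := sum_exponents_eq hf hm
  have h0 : (1 : TernaryRing) ∈ q.reducible 0 := by
    convert q.residue_mem_reducible 0 (0, 0)
    simp [residue]
  have := Submodule.smul_mem _ (coeff m f) (q.X_pow_mul_mem_reducible
    (q.X_pow_mul_mem_reducible (q.X_pow_mul_mem_reducible h0 0 (m 0)) 1 (m 1)) 2 (m 2))
  rw [zero_add, hdeg] at this
  convert this using 1
  rw [monomial_eq, Finsupp.prod_fintype _ _ (by simp), Fin.prod_univ_three, C_mul']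
  ring_nf

/-- Membership of a form in the ideal of a 2-square is decided by the four conditions. -/
lemma mem_ideal_iff (q : Sq) {d : ℕ} {f : TernaryRing} (hf : f.IsHomogeneous d) :
    f ∈ q.ideal ↔ q.conditions f = 0 := by
  refine ⟨q.conditions_eq_zero_of_mem_ideal, fun h => ?_⟩
  obtain ⟨g, hg, r, hr, rfl⟩ := Submodule.mem_sup.mp (q.mem_reducible hf)
  have hg' : g ∈ q.ideal := hg
  rw [map_add, q.conditions_eq_zero_of_mem_ideal hg', zero_add] at h
  obtain ⟨c, rfl⟩ := (Submodule.mem_span_range_iff_exists_fun ℂ).mp hr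
  suffices h0 : ∑ i, c i • q.residue d i = 0 by rwa [h0, add_zero]
  rw [conditions_eq_zero_iff] at h
  simp only [Fintype.sum_prod_type, Fin.sum_univ_two] at h ⊢
  have hΔ := q.det_ne_zero
  rcases d with _ | _ | d
  · simp [residue] at h ⊢
    exact h
  · simp [residue, pderiv_X] at h ⊢
    obtain ⟨e0, e1, e2⟩ := h
    have e3 : c (1, 0) = 0 := by
      refine (mul_eq_zero.mp (?_ : (q.u₁ * q.v₂ - q.u₂ * q.v₁) * _ = 0)).resolve_left hΔ
      linear_combination q.u₁ * e1 + q.u₂ * e2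
    have e4 : c (0, 1) = 0 := by
      refine (mul_eq_zero.mp (?_ : (q.u₁ * q.v₂ - q.u₂ * q.v₁) * _ = 0)).resolve_left hΔ
      linear_combination q.v₁ * e1 + q.v₂ * e2
    simp [e0, e3, e4]
  · simp [residue, pderiv_X, Derivation.leibniz, Derivation.leibniz_pow] at h ⊢
    obtain ⟨e0, e1, e2, e5⟩ := h
    have e3 : c (1, 0) = 0 := by
      refine (mul_eq_zero.mp (?_ : (q.u₁ * q.v₂ - q.u₂ * q.v₁) * _ = 0)).resolve_left hΔ
      linear_combination q.u₁ * e1 + q.u₂ * e2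
    have e4 : c (0, 1) = 0 := by
      refine (mul_eq_zero.mp (?_ : (q.u₁ * q.v₂ - q.u₂ * q.v₁) * _ = 0)).resolve_left hΔ
      linear_combination q.v₁ * e1 + q.v₂ * e2
    have e6 : c (1, 1) = 0 := by
      refine (mul_eq_zero.mp (?_ : (q.u₁ * q.v₂ - q.u₂ * q.v₁) ^ 2 * _ = 0)).resolve_left
        (pow_ne_zero 2 hΔ)
      linear_combination e5
    simp [e0, e3, e4, e6]

end Sq

end Squares

section Dimension

lemma pderiv_comm (i j : Fin 3) (f : TernaryRing) :
    pderiv i (pderiv j f) = pderiv j (pderiv i f) := by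
  have h : ⁅(pderiv i : Derivation ℂ TernaryRing TernaryRing),
      (pderiv j : Derivation ℂ TernaryRing TernaryRing)⁆ = 0 := by
    apply derivation_ext
    intro k
    simp [Derivation.commutator_apply, pderiv_X, Pi.single_apply, apply_ite]
  have := DFunLike.congr_fun h f
  rwa [Derivation.commutator_apply, Derivation.zero_apply, sub_eq_zero] at this

/-- The dimension of the space of ternary forms of degree `d`. -/
def formDim (d : ℕ) : ℕ := (d + 2) * (d + 1) / 2

lemma formDim_add_two (d : ℕ) : formDim (d + 2) = formDim d + 2 * d + 5 := by
  rw [formDim, formDim, show (d + 2 + 2) * (d + 2 + 1) = (d + 2) * (d + 1) + 2 * (2 * d + 5) by ring]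
  omega

instance (d : ℕ) : FiniteDimensional ℂ (homogeneousSubmodule (Fin 3) ℂ d) :=
  Module.Finite.iff_fg.mpr (homogeneousSubmodule_fg _ _ d)

lemma finrank_homogeneousSubmodule (d : ℕ) :
    Module.finrank ℂ (homogeneousSubmodule (Fin 3) ℂ d) = formDim d := by
  rw [homogeneousSubmodule_eq_finsupp_supported,
    Module.finrank_eq_nat_card_basis
      (Module.Basis.ofRepr (AddMonoidAlgebra.supportedEquivFinsupp
        (R := ℂ) (S := ℂ) {m : Fin 3 →₀ ℕ | m.degree = d}))]
  have h : {m : Fin 3 →₀ ℕ | m.degree = d} =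
      ((Finset.univ.finsuppAntidiag d : Finset (Fin 3 →₀ ℕ)) : Set (Fin 3 →₀ ℕ)) := by
    ext m
    simp [Finsupp.degree_eq_sum]
  rw [h, Nat.card_coe_set_eq, Set.ncard_coe_finset, Finset.card_finsuppAntidiag_nat_eq_choose]
  simp only [Finset.card_univ, Fintype.card_fin]
  rw [show 3 + d - 1 = d + 2 by omega, ← Nat.choose_symm (by omega),
    show d + 2 - d = 2 by omega, Nat.choose_two_right, formDim]
  simp

lemma finrank_le_finrank_inf_ker_add {M : Type*} [AddCommGroup M] [Module ℂ M] {n : ℕ}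
    (V : Submodule ℂ M) [FiniteDimensional ℂ V] (T : M →ₗ[ℂ] (Fin n → ℂ)) :
    Module.finrank ℂ V ≤ Module.finrank ℂ (V ⊓ LinearMap.ker T : Submodule ℂ M) + n := by
  have h1 := LinearMap.finrank_range_add_finrank_ker (T.domRestrict V)
  have h2 : (LinearMap.ker (T.domRestrict V)).map V.subtype = V ⊓ LinearMap.ker T := by
    rw [← Submodule.map_comap_subtype]
    rfl
  have h3 : Module.finrank ℂ (LinearMap.ker (T.domRestrict V)) =
      Module.finrank ℂ (V ⊓ LinearMap.ker T : Submodule ℂ M) := by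
    rw [← h2]
    exact (Submodule.finrank_map_subtype_eq V _).symm
  have h4 : Module.finrank ℂ (LinearMap.range (T.domRestrict V)) ≤ n := by
    simpa using Submodule.finrank_le (LinearMap.range (T.domRestrict V))
  omega

/-- If every element of `V` on which `T` vanishes lies in the image of `U` under an injective
linear map, then the rank of `V` is bounded in terms of that of `U`. -/
lemma finrank_le_of_forall_exists {M : Type*} [AddCommGroup M] [Module ℂ M]
    (V U : Submodule ℂ M) [FiniteDimensional ℂ V] [FiniteDimensional ℂ U] (φ : M →ₗ[ℂ] M)
    (h : ∀ f ∈ V, ∃ g ∈ U, f = φ g) : Module.finrank ℂ V ≤ Module.finrank ℂ U :=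
  (Submodule.finrank_mono (fun f hf => by
    obtain ⟨g, hg, rfl⟩ := h f hf
    exact Submodule.mem_map_of_mem hg : V ≤ U.map φ)).trans (Submodule.finrank_map_le φ U)

/-- Forms of degree `d` in the ideals of all the 2-squares of a list. -/
noncomputable def forms (X : List Sq) (d : ℕ) : Submodule ℂ TernaryRing :=
  homogeneousSubmodule (Fin 3) ℂ d ⊓ ⨅ q ∈ X, LinearMap.ker q.conditions

lemma mem_forms {X : List Sq} {d : ℕ} {f : TernaryRing} :
    f ∈ forms X d ↔ f.IsHomogeneous d ∧ ∀ q ∈ X, q.conditions f = 0 := by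
  simp [forms, Submodule.mem_iInf]

instance (X : List Sq) (d : ℕ) : FiniteDimensional ℂ (forms X d) :=
  Submodule.finiteDimensional_inf_left _ _

lemma forms_nil (d : ℕ) : forms [] d = homogeneousSubmodule (Fin 3) ℂ d := by
  simp [forms]

lemma forms_cons (q : Sq) (X : List Sq) (d : ℕ) :
    forms (q :: X) d = forms X d ⊓ LinearMap.ker q.conditions := by
  ext f
  simp [mem_forms]
  tauto

lemma finrank_forms_cons_ge (q : Sq) (X : List Sq) (d : ℕ) :
    Module.finrank ℂ (forms X d) ≤ Module.finrank ℂ (forms (q :: X) d) + 4 := by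
  rw [forms_cons]
  exact finrank_le_finrank_inf_ker_add _ _

lemma formDim_le_finrank_forms_add (X : List Sq) (d : ℕ) :
    formDim d ≤ Module.finrank ℂ (forms X d) + 4 * X.length := by
  induction X with
  | nil => rw [forms_nil, finrank_homogeneousSubmodule]; exact Nat.le_add_right _ _
  | cons q X ih =>
    have := finrank_forms_cons_ge q X d
    simp only [List.length_cons]
    omega

lemma restrictScalars_iInf_ideal_inf (X : List Sq) (d : ℕ) :
    (Submodule.restrictScalars ℂ (⨅ i : Fin X.length, (X.get i).ideal) ⊓
      homogeneousSubmodule (Fin 3) ℂ d : Submodule ℂ TernaryRing) = forms X d := by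
  ext f
  rw [Submodule.mem_inf, Submodule.restrictScalars_mem, Submodule.mem_iInf, mem_forms,
    mem_homogeneousSubmodule, and_comm, and_congr_right_iff]
  intro hf
  simp only [Sq.mem_ideal_iff _ hf, List.get_eq_getElem, List.forall_mem_iff_getElem,
    Fin.forall_iff]

end Dimension

section Killing

/-- If no nonzero form of `V` is singular at a point with tangent cone containing the direction
`(w, 1)`, then some 2-square at this point kills `V`. -/
lemma exists_sq_of_tangent (V : Submodule ℂ TernaryRing) (a b w : ℂ)
    (h : ∀ f ∈ V, eval ![a, b, 1] f = 0 → eval ![a, b, 1] (pderiv 0 f) = 0 →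
      eval ![a, b, 1] (pderiv 1 f) = 0 →
      w ^ 2 * eval ![a, b, 1] (pderiv 0 (pderiv 0 f)) +
        2 * w * eval ![a, b, 1] (pderiv 1 (pderiv 0 f)) +
        eval ![a, b, 1] (pderiv 1 (pderiv 1 f)) = 0 → f = 0) :
    ∃ q : Sq, q.point = (a, b) ∧ ∀ f ∈ V, q.conditions f = 0 → f = 0 := by
  by_contra! hcon
  obtain ⟨f, hfV, hf, hf0⟩ := hcon ⟨a, b, w, 1, w + 1, 1, by simp⟩ rfl
  obtain ⟨g, hgV, hg, hg0⟩ := hcon ⟨a, b, w, 1, w + 2, 1, by simp⟩ rfl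
  rw [Sq.conditions_eq_zero_iff] at hf hg
  obtain ⟨f1, f2, f3, f4⟩ := hf
  obtain ⟨g1, g2, g3, g4⟩ := hg
  set A : TernaryRing → ℂ := fun f => w ^ 2 * eval ![a, b, 1] (pderiv 0 (pderiv 0 f)) +
    2 * w * eval ![a, b, 1] (pderiv 1 (pderiv 0 f)) +
    eval ![a, b, 1] (pderiv 1 (pderiv 1 f)) with hA
  set B : TernaryRing → ℂ := fun f => w * eval ![a, b, 1] (pderiv 0 (pderiv 0 f)) +
    eval ![a, b, 1] (pderiv 1 (pderiv 0 f)) with hB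
  have hfA : A f ≠ 0 := fun h0 => hf0 (h f hfV f1 f2 f3 h0)
  have hgA : A g ≠ 0 := fun h0 => hg0 (h g hgV g1 g2 g3 h0)
  have hfB : A f + B f = 0 := by simp only [hA, hB]; linear_combination f4
  have hgB : A g + 2 * B g = 0 := by simp only [hA, hB]; linear_combination g4
  have hk : A g • f - A f • g = 0 := by
    apply h _ (sub_mem (V.smul_mem _ hfV) (V.smul_mem _ hgV))
    · simp [smul_eval, f1, g1]
    · simp [smul_eval, f2, g2]
    · simp [smul_eval, f3, g3]
    · simp only [map_sub, Derivation.map_smul, smul_eval]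
      simp only [hA]
      ring
  have hBk : A g * B f - A f * B g = 0 := by
    have : B (A g • f - A f • g) = 0 := by rw [hk]; simp [hB]
    rw [← this]
    simp only [hB, map_sub, Derivation.map_smul, smul_eval]
    ring
  exact mul_ne_zero hfA hgA (by linear_combination -2 * hBk + 2 * A g * hfB - A f * hgB)

/-- A space of forms of dimension at most three is killed by a suitable 2-square. -/
lemma exists_sq_of_finrank_le_three {d : ℕ} (V : Submodule ℂ TernaryRing)
    [FiniteDimensional ℂ V] (hV : ∀ f ∈ V, f.IsHomogeneous d) (hrank : Module.finrank ℂ V ≤ 3)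
    {F : Set (ℂ × ℂ)} (hF : F.Finite) :
    ∃ q : Sq, q.point ∉ F ∧ ∀ f ∈ V, q.conditions f = 0 → f = 0 := by
  obtain ⟨t, ht, hker⟩ := exists_forall_pow_dvd_eq_zero 3 (V.map (kronecker (d + 1)).toLinearMap)
    ((Submodule.finrank_map_le _ _).trans hrank) (Prod.snd '' F) (hF.image _)
  obtain ⟨q, hq, hkill⟩ := exists_sq_of_tangent V (t ^ (d + 1)) t ((d + 1) * t ^ d) (by
    intro f hfV h1 h2 h3 h4
    apply eq_zero_of_kronecker_eq_zero (hV f hfV)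
    refine hker _ (Submodule.mem_map_of_mem hfV) (cube_dvd_of_eval ?_ ?_ ?_)
    · simpa [eval_kronecker] using h1
    · simp [derivative_kronecker, eval_kronecker, h2, h3]
    · simp only [derivative_kronecker, Polynomial.derivative_add,
        Polynomial.derivative_mul, Polynomial.eval_add, Polynomial.eval_mul, eval_kronecker, h2,
        pderiv_comm 0 1 f]
      simp
      linear_combination h4)
  refine ⟨q, fun hmem => ht ⟨_, hmem, by rw [hq]⟩, hkill⟩

end Killing

section Lines

namespace Sq

/-- A 2-square at `[c : b : 1]` adapted to the line `x = c z`. -/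
def adapted (c b : ℂ) : Sq := ⟨c, b, 1, 0, 0, 1, by simp⟩

/-- A 2-square at `[c : b : 1]` with a tangent direction along `y = b z` and a skew one. -/
def skew (c b : ℂ) : Sq := ⟨c, b, 1, 0, 1, 1, by simp⟩

lemma conditions_vline_sq_mul {q : Sq} {c : ℂ} (hq : q.a ≠ c) {h : TernaryRing}
    (hh : q.conditions (vline c ^ 2 * h) = 0) : q.conditions h = 0 := by
  rw [conditions_eq_zero_iff] at hh ⊢
  have hl : q.a - c ≠ 0 := sub_ne_zero.mpr hq
  simp only [vline, pow_two, Derivation.leibniz, smul_eq_mul, map_add, map_mul, map_sub, pderiv_X,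
    pderiv_C, eval_C, eval_X] at hh
  simp at hh
  obtain ⟨h1, h2, h3, h4⟩ := hh
  have e1 : eval ![q.a, q.b, 1] h = 0 := h1.resolve_left hl
  rw [e1] at h2 h4
  have e2 : eval ![q.a, q.b, 1] (pderiv 0 h) = 0 := by
    refine (mul_eq_zero.mp (?_ : (q.a - c) ^ 2 * _ = 0)).resolve_left (pow_ne_zero 2 hl)
    linear_combination h2
  have e3 : eval ![q.a, q.b, 1] (pderiv 1 h) = 0 := h3.resolve_left hl
  rw [e2, e3] at h4
  refine ⟨e1, e2, e3, ?_⟩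
  refine (mul_eq_zero.mp (?_ : (q.a - c) ^ 2 * _ = 0)).resolve_left (pow_ne_zero 2 hl)
  linear_combination h4

lemma sq_dvd_restrict {q : Sq} {c b : ℂ} (hq : q.point = (c, b)) {f : TernaryRing}
    (hf : q.conditions f = 0) : (Polynomial.X - Polynomial.C b) ^ 2 ∣ restrict c f := by
  obtain ⟨rfl, rfl⟩ := Prod.mk.inj hq
  rw [conditions_eq_zero_iff] at hf
  apply sq_dvd_of_eval
  · rw [eval_restrict, hf.1]
  · rw [derivative_restrict, eval_restrict, hf.2.2.1]

lemma dvd_restrict_pderiv {q : Sq} {c b : ℂ} (hq : q.point = (c, b)) {f : TernaryRing}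
    (hf : q.conditions f = 0) :
    Polynomial.X - Polynomial.C b ∣ restrict c (pderiv 0 f) := by
  obtain ⟨rfl, rfl⟩ := Prod.mk.inj hq
  rw [conditions_eq_zero_iff] at hf
  rw [Polynomial.dvd_iff_isRoot, Polynomial.IsRoot, eval_restrict, hf.2.1]

lemma sq_dvd_restrict_pderiv {c b : ℂ} {f : TernaryRing} (hf : (adapted c b).conditions f = 0) :
    (Polynomial.X - Polynomial.C b) ^ 2 ∣ restrict c (pderiv 0 f) := by
  rw [conditions_eq_zero_iff] at hf
  simp only [adapted] at hf
  apply sq_dvd_of_eval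
  · rw [eval_restrict, hf.2.1]
  · rw [derivative_restrict, eval_restrict]
    simpa using hf.2.2.2

end Sq

/-- Adapted 2-squares at `[c : b + i + 1 : 1]` for `i < m`. -/
noncomputable def lineSquares (c b : ℂ) (m : ℕ) : List Sq :=
  (List.range m).map fun i : ℕ => Sq.adapted c (b + 1 + (i : ℂ))

@[simp] lemma length_lineSquares (c b : ℂ) (m : ℕ) : (lineSquares c b m).length = m := by
  simp [lineSquares]

lemma a_eq_of_mem_lineSquares {c b : ℂ} {m : ℕ} {q : Sq} (hq : q ∈ lineSquares c b m) :
    q.a = c := by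
  simp only [lineSquares, List.mem_map] at hq
  obtain ⟨i, -, rfl⟩ := hq
  rfl

lemma nodup_lineSquares_append {X : List Sq} (hX : (X.map Sq.point).Nodup) {c : ℂ}
    (hc : ∀ q ∈ X, q.a ≠ c) (b : ℂ) (m : ℕ) :
    ((lineSquares c b m ++ X).map Sq.point).Nodup := by
  rw [List.map_append, List.nodup_append]
  refine ⟨?_, hX, ?_⟩
  · rw [lineSquares, List.map_map]
    refine List.Nodup.map ?_ List.nodup_range
    intro i j hij
    simpa [Sq.point, Sq.adapted] using hij
  · intro p hp p' hp' heq
    obtain ⟨q, hq, rfl⟩ := List.mem_map.mp hp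
    obtain ⟨q', hq', rfl⟩ := List.mem_map.mp hp'
    exact hc q' hq' ((congrArg Prod.fst heq).symm.trans (a_eq_of_mem_lineSquares hq))

lemma point_skew_notMem {X : List Sq} {c : ℂ} (hc : ∀ q ∈ X, q.a ≠ c) (b : ℂ) (m : ℕ) :
    (Sq.skew c b).point ∉ (lineSquares c b m ++ X).map Sq.point := by
  rw [List.map_append, List.mem_append, not_or]
  constructor
  · simp only [lineSquares, List.map_map, List.mem_map, not_exists, not_and]
    intro i _ h
    have h2 := congrArg Prod.snd h
    simp only [Function.comp, Sq.point, Sq.adapted, Sq.skew, add_assoc, add_eq_left] at h2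
    exact Nat.cast_add_one_ne_zero (R := ℂ) i (by rw [add_comm]; exact h2)
  · rw [List.mem_map]
    rintro ⟨q, hq, h⟩
    exact hc q hq (congrArg Prod.fst h)

/-- The ordinates of the points of `lineSquares`. -/
noncomputable def ordinates (b : ℂ) (m : ℕ) : Finset ℂ :=
  (Finset.range m).image fun i : ℕ => b + 1 + (i : ℂ)

lemma card_ordinates (b : ℂ) (m : ℕ) : (ordinates b m).card = m := by
  rw [ordinates, Finset.card_image_of_injective, Finset.card_range]
  intro i j hij
  simpa using hij

lemma notMem_ordinates (b : ℂ) (m : ℕ) : b ∉ ordinates b m := by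
  simp only [ordinates, Finset.mem_image, not_exists, not_and]
  intro i _ h
  rw [add_assoc, add_eq_left] at h
  exact Nat.cast_add_one_ne_zero (R := ℂ) i (by rw [add_comm]; exact h)

lemma conditions_of_mem_ordinates {c b : ℂ} {m : ℕ} {f : TernaryRing}
    (hf : ∀ q ∈ lineSquares c b m, q.conditions f = 0) {t : ℂ} (ht : t ∈ ordinates b m) :
    (Sq.adapted c t).conditions f = 0 := by
  obtain ⟨i, hi, rfl⟩ := Finset.mem_image.mp ht
  exact hf _ (List.mem_map.mpr ⟨i, List.mem_range.mpr (Finset.mem_range.mp hi), rfl⟩)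

lemma exists_mem_forms_of_even {X : List Sq} {k : ℕ} {c b : ℂ} (hc : ∀ q ∈ X, q.a ≠ c)
    {f : TernaryRing} (hf : f ∈ forms (lineSquares c b (k + 1) ++ X) (2 * k + 2))
    (hcoeff : f.coeff (Finsupp.single 1 (2 * k + 2)) = 0) :
    ∃ h ∈ forms X (2 * k), f = vline c ^ 2 * h := by
  rw [mem_forms] at hf
  obtain ⟨hhom, hcond⟩ := hf
  have hline : ∀ t ∈ ordinates b (k + 1), (Sq.adapted c t).conditions f = 0 := fun t ht =>
    conditions_of_mem_ordinates (fun q hq => hcond q (List.mem_append_left _ hq)) ht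
  have hsum : ∑ t ∈ ordinates b (k + 1), 2 = 2 * k + 2 := by
    rw [Finset.sum_const, card_ordinates, smul_eq_mul]; ring
  have h0 : restrict c f = 0 := by
    have hd : ∀ t ∈ ordinates b (k + 1),
        (Polynomial.X - Polynomial.C t) ^ 2 ∣ restrict c f :=
      fun t ht => Sq.sq_dvd_restrict (q := Sq.adapted c t) rfl (hline t ht)
    refine eq_zero_of_pow_dvd_of_degree_lt (ordinates b (k + 1)) (fun _ => 2) hd ?_
    rw [hsum, Polynomial.degree_lt_iff_coeff_zero]
    intro n hn
    rcases hn.eq_or_lt with rfl | hlt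
    · rw [coeff_restrict hhom, hcoeff]
    · exact Polynomial.coeff_eq_zero_of_natDegree_lt ((natDegree_restrict_le hhom c).trans_lt hlt)
  have h1 : restrict c (pderiv 0 f) = 0 := by
    have hd : ∀ t ∈ ordinates b (k + 1),
        (Polynomial.X - Polynomial.C t) ^ 2 ∣ restrict c (pderiv 0 f) :=
      fun t ht => Sq.sq_dvd_restrict_pderiv (hline t ht)
    refine eq_zero_of_pow_dvd_of_degree_lt (ordinates b (k + 1)) (fun _ => 2) hd ?_
    rw [hsum]
    refine (Polynomial.degree_le_of_natDegree_le (natDegree_restrict_pderiv_le hhom 0 c)).trans_lt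
      ?_
    exact_mod_cast Nat.lt_succ_self _
  obtain ⟨h, hh, rfl⟩ := exists_eq_vline_sq_mul hhom h0 h1
  exact ⟨h, mem_forms.mpr ⟨hh, fun q hq => Sq.conditions_vline_sq_mul (hc q hq)
    (hcond q (List.mem_append_right _ hq))⟩, rfl⟩

lemma finrank_forms_lineSquares_append_le {X : List Sq} {k : ℕ} {c : ℂ} (b : ℂ)
    (hc : ∀ q ∈ X, q.a ≠ c) :
    Module.finrank ℂ (forms (lineSquares c b (k + 1) ++ X) (2 * k + 2)) ≤
      Module.finrank ℂ (forms X (2 * k)) + 1 := by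
  let T : TernaryRing →ₗ[ℂ] (Fin 1 → ℂ) :=
    LinearMap.pi fun _ => lcoeff ℂ (Finsupp.single 1 (2 * k + 2))
  refine (finrank_le_finrank_inf_ker_add _ T).trans (Nat.add_le_add_right ?_ 1)
  refine finrank_le_of_forall_exists _ _ (LinearMap.mulLeft ℂ (vline c ^ 2)) ?_
  rintro f ⟨hf, hT⟩
  exact exists_mem_forms_of_even hc hf (congrFun (LinearMap.mem_ker.mp hT) 0)

lemma exists_mem_forms_of_odd {X : List Sq} {k : ℕ} {c b : ℂ} (hc : ∀ q ∈ X, q.a ≠ c)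
    {f : TernaryRing}
    (hf : f ∈ forms (Sq.skew c b :: (lineSquares c b (k + 1) ++ X)) (2 * k + 3)) :
    ∃ h ∈ forms X (2 * k + 1), eval ![c, b, 1] h = 0 ∧ f = vline c ^ 2 * h := by
  rw [mem_forms] at hf
  obtain ⟨hhom, hcond⟩ := hf
  have hline : ∀ t ∈ ordinates b (k + 1), (Sq.adapted c t).conditions f = 0 := fun t ht =>
    conditions_of_mem_ordinates
      (fun q hq => hcond q (List.mem_cons_of_mem _ (List.mem_append_left _ hq))) ht
  have hskew : (Sq.skew c b).conditions f = 0 := hcond _ List.mem_cons_self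
  have hb := notMem_ordinates b (k + 1)
  have h0 : restrict c f = 0 := by
    have hd : ∀ t ∈ insert b (ordinates b (k + 1)),
        (Polynomial.X - Polynomial.C t) ^ 2 ∣ restrict c f := by
      intro t ht
      rcases Finset.mem_insert.mp ht with rfl | ht
      · exact Sq.sq_dvd_restrict (q := Sq.skew c t) rfl hskew
      · exact Sq.sq_dvd_restrict (q := Sq.adapted c t) rfl (hline t ht)
    refine eq_zero_of_pow_dvd_of_degree_lt (insert b (ordinates b (k + 1))) (fun _ => 2) hd ?_
    · rw [Finset.sum_insert hb, Finset.sum_const, card_ordinates]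
      refine (Polynomial.degree_le_of_natDegree_le (natDegree_restrict_le hhom c)).trans_lt ?_
      norm_cast
      simp only [smul_eq_mul]
      omega
  have h1 : restrict c (pderiv 0 f) = 0 := by
    have hd : ∀ t ∈ insert b (ordinates b (k + 1)),
        (Polynomial.X - Polynomial.C t) ^ (if t = b then 1 else 2) ∣
          restrict c (pderiv 0 f) := by
      intro t ht
      rcases Finset.mem_insert.mp ht with rfl | ht
      · rw [if_pos rfl, pow_one]
        exact Sq.dvd_restrict_pderiv (q := Sq.skew c t) rfl hskew
      · rw [if_neg (ne_of_mem_of_not_mem ht hb)]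
        exact Sq.sq_dvd_restrict_pderiv (hline t ht)
    refine eq_zero_of_pow_dvd_of_degree_lt (insert b (ordinates b (k + 1)))
      (fun t => if t = b then 1 else 2) hd ?_
    · rw [Finset.sum_insert hb, if_pos rfl, Finset.sum_congr rfl
        (fun t ht => if_neg (ne_of_mem_of_not_mem ht hb)), Finset.sum_const, card_ordinates]
      refine (Polynomial.degree_le_of_natDegree_le
        (natDegree_restrict_pderiv_le hhom 0 c)).trans_lt ?_
      norm_cast
      simp only [smul_eq_mul]
      omega
  obtain ⟨h, hh, rfl⟩ := exists_eq_vline_sq_mul hhom h0 h1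
  refine ⟨h, mem_forms.mpr ⟨hh, fun q hq => Sq.conditions_vline_sq_mul (hc q hq)
    (hcond q (List.mem_cons_of_mem _ (List.mem_append_right _ hq)))⟩, ?_, rfl⟩
  rw [Sq.conditions_eq_zero_iff] at hskew
  have h4 := hskew.2.2.2
  simp only [Sq.skew, vline, pow_two, Derivation.leibniz, smul_eq_mul, map_add, map_mul, map_sub,
    pderiv_X, pderiv_C, eval_C, eval_X] at h4
  simpa using h4

end Lines

section Perturbation

/-- A linear map depending continuously on a parameter and injective for one value of it stays
injective nearby. -/
lemma eventually_injective_of_continuous {M : Type*} [AddCommGroup M] [Module ℂ M]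
    [FiniteDimensional ℂ M] {n : ℕ} (T : ℂ → M →ₗ[ℂ] (Fin n → ℂ))
    (hT : ∀ x, Continuous fun ε => T ε x) (h0 : ∀ x, T 0 x = 0 → x = 0) :
    ∀ᶠ ε in nhds 0, ∀ x, T ε x = 0 → x = 0 := by
  let v := Module.finBasis ℂ M
  have hcont : Continuous fun ε => fun i => T ε (v i) := continuous_pi fun i => hT (v i)
  have hli : LinearIndependent ℂ fun i => T 0 (v i) :=
    v.linearIndependent.map' (T 0) (LinearMap.ker_eq_bot'.mpr h0)
  filter_upwards [hcont.continuousAt.eventually hli.eventually] with ε hε x hx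
  rw [← v.sum_repr x, map_sum] at hx
  simp only [map_smul] at hx
  have hrepr := Fintype.linearIndependent_iff.mp hε _ hx
  rw [← v.sum_repr x]
  simp [hrepr]

/-- The conditions imposed at `[c + ε : b : 1]` on the forms `ε² μ f₀ + (x - c z)² h`, rescaled
so as to have a limit when `ε` tends to zero. -/
noncomputable def rescaledConditions (c b : ℂ) (f₀ : TernaryRing) (U : Submodule ℂ TernaryRing)
    (ε : ℂ) : (ℂ × U) →ₗ[ℂ] (Fin 4 → ℂ) :=
  let E : TernaryRing →ₗ[ℂ] ℂ := (aeval ![c + ε, b, 1]).toLinearMap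
  let μ : (ℂ × U) →ₗ[ℂ] ℂ := LinearMap.fst ℂ ℂ U
  let h : (ℂ × U) →ₗ[ℂ] TernaryRing := U.subtype ∘ₗ LinearMap.snd ℂ ℂ U
  LinearMap.pi ![
    (2 * E f₀ - ε * E (pderiv 0 f₀)) • μ - ε • (E ∘ₗ (pderiv 0).toLinearMap ∘ₗ h),
    E f₀ • μ + E ∘ₗ h,
    E (pderiv 1 f₀) • μ + E ∘ₗ (pderiv 1).toLinearMap ∘ₗ h,
    E (pderiv 1 (pderiv 1 f₀)) • μ +
      E ∘ₗ (pderiv 1).toLinearMap ∘ₗ (pderiv 1).toLinearMap ∘ₗ h]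

lemma rescaledConditions_apply (c b : ℂ) (f₀ : TernaryRing) (U : Submodule ℂ TernaryRing)
    (ε μ : ℂ) (h : U) :
    rescaledConditions c b f₀ U ε (μ, h) = ![
      (2 * eval ![c + ε, b, 1] f₀ - ε * eval ![c + ε, b, 1] (pderiv 0 f₀)) * μ -
        ε * eval ![c + ε, b, 1] (pderiv 0 (h : TernaryRing)),
      eval ![c + ε, b, 1] f₀ * μ + eval ![c + ε, b, 1] (h : TernaryRing),
      eval ![c + ε, b, 1] (pderiv 1 f₀) * μ + eval ![c + ε, b, 1] (pderiv 1 (h : TernaryRing)),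
      eval ![c + ε, b, 1] (pderiv 1 (pderiv 1 f₀)) * μ +
        eval ![c + ε, b, 1] (pderiv 1 (pderiv 1 (h : TernaryRing)))] := by
  ext i
  fin_cases i <;> simp [rescaledConditions, aeval_eq_eval]

lemma continuous_rescaledConditions (c b : ℂ) (f₀ : TernaryRing) (U : Submodule ℂ TernaryRing)
    (x : ℂ × U) : Continuous fun ε => rescaledConditions c b f₀ U ε x := by
  obtain ⟨μ, h⟩ := x
  have hE : ∀ g : TernaryRing, Continuous fun ε : ℂ => eval ![c + ε, b, 1] g := fun g =>
    (continuous_eval g).comp (continuous_pi fun i => by fin_cases i <;> simp <;> fun_prop)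
  simp only [rescaledConditions_apply]
  refine continuous_pi fun i => ?_
  have h1 := hE f₀
  have h2 := hE (pderiv 0 f₀)
  have h3 := hE (pderiv 0 (h : TernaryRing))
  have h4 := hE (h : TernaryRing)
  have h5 := hE (pderiv 1 f₀)
  have h6 := hE (pderiv 1 (h : TernaryRing))
  have h7 := hE (pderiv 1 (pderiv 1 f₀))
  have h8 := hE (pderiv 1 (pderiv 1 (h : TernaryRing)))
  fin_cases i <;> simp <;> fun_prop

/-- Near the line `x = c z` there is a 2-square killing the span of `f₀` and `(x - c z)² U`. -/
lemma exists_sq_of_perturbation {c : ℂ} {f₀ : TernaryRing} (hf₀ : restrict c f₀ ≠ 0)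
    (V U : Submodule ℂ TernaryRing) [FiniteDimensional ℂ U] (hrank : Module.finrank ℂ U ≤ 3)
    (hU : ∀ h ∈ U, restrict c h = 0 → h = 0)
    (hV : ∀ f ∈ V, ∃ r : ℂ, ∃ h ∈ U, f = C r * f₀ + vline c ^ 2 * h)
    {F : Set (ℂ × ℂ)} (hF : F.Finite) :
    ∃ q : Sq, q.point ∉ F ∧ ∀ f ∈ V, q.conditions f = 0 → f = 0 := by
  obtain ⟨b, hb, hker⟩ := exists_forall_pow_dvd_eq_zero 3 (U.map (restrict c).toLinearMap)
    ((Submodule.finrank_map_le _ _).trans hrank) {t | (restrict c f₀).IsRoot t}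
    (Polynomial.finite_setOfPred_isRoot hf₀)
  have hb' : eval ![c, b, 1] f₀ ≠ 0 := by rwa [← eval_restrict]
  have hinj : ∀ x, rescaledConditions c b f₀ U 0 x = 0 → x = 0 := by
    rintro ⟨μ, h⟩ hx
    rw [rescaledConditions_apply] at hx
    have e0 := congrFun hx 0
    have e1 := congrFun hx 1
    have e2 := congrFun hx 2
    have e3 := congrFun hx 3
    simp [hb'] at e0 e1 e2 e3
    subst e0
    simp only [mul_zero, zero_add] at e1 e2 e3
    have : (h : TernaryRing) = 0 := by
      apply hU _ h.2
      refine hker _ (Submodule.mem_map_of_mem h.2) (cube_dvd_of_eval ?_ ?_ ?_)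
      · simpa [eval_restrict] using e1
      · simpa [derivative_restrict, eval_restrict] using e2
      · simpa [derivative_restrict, eval_restrict] using e3
    simpa using this
  have hev := eventually_injective_of_continuous _ (continuous_rescaledConditions c b f₀ U) hinj
  have hfin : (insert 0 ((fun p : ℂ × ℂ => p.1 - c) '' F)).Finite := (hF.image _).insert 0
  obtain ⟨ε, hε, hεF⟩ : ∃ ε, (∀ x, rescaledConditions c b f₀ U ε x = 0 → x = 0) ∧
      ε ∉ insert 0 ((fun p : ℂ × ℂ => p.1 - c) '' F) := by
    have h1 : ∀ᶠ ε in nhdsWithin (0 : ℂ) {0}ᶜ,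
        ε ∉ insert 0 ((fun p : ℂ × ℂ => p.1 - c) '' F) := by
      have h2 := (hfin.subset Set.sdiff_subset :
        ((insert 0 ((fun p : ℂ × ℂ => p.1 - c) '' F)) \ {0}).Finite).isClosed.isOpen_compl
      have h3 := nhdsWithin_le_nhds (s := {0}ᶜ) (h2.mem_nhds (x := (0 : ℂ)) (by simp))
      filter_upwards [h3, self_mem_nhdsWithin] with ε h4 h5 h6
      exact h4 ⟨h6, h5⟩
    exact ((hev.filter_mono nhdsWithin_le_nhds).and h1).exists
  have hε0 : ε ≠ 0 := fun h => hεF (h ▸ Set.mem_insert _ _)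
  obtain ⟨q, hq, hkill⟩ := exists_sq_of_tangent V (c + ε) b 0 (by
    intro f hfV h1 h2 h3 h4
    obtain ⟨r, h, hh, rfl⟩ := hV f hfV
    simp only [vline, pow_two, Derivation.leibniz, smul_eq_mul, map_add, map_mul, map_sub, pderiv_X,
      pderiv_C, eval_C, eval_X] at h1 h2 h3 h4
    simp at h1 h2 h3 h4
    have hx := hε (r / ε ^ 2, ⟨h, hh⟩) (by
      have e1 : eval ![c + ε, b, 1] f₀ * (r / ε ^ 2) + eval ![c + ε, b, 1] h = 0 := by
        field_simp
        linear_combination h1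
      rw [rescaledConditions_apply]
      ext i
      fin_cases i
      · have e2 : eval ![c + ε, b, 1] (pderiv 0 f₀) * (r / ε ^ 2) * ε + 2 * eval ![c + ε, b, 1] h +
            ε * eval ![c + ε, b, 1] (pderiv 0 h) = 0 := by
          field_simp
          linear_combination h2
        simp
        linear_combination 2 * e1 - e2
      · simpa using e1
      · simp
        field_simp
        linear_combination h3
      · simp
        field_simp
        linear_combination h4)
    have hr : r = 0 := by simpa [hε0] using congrArg Prod.fst hx
    have hh0 : h = 0 := congrArg (fun x : ℂ × U => (x.2 : TernaryRing)) hx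
    simp [hr, hh0])
  refine ⟨q, fun hmem => hεF (Set.mem_insert_of_mem _ ⟨_, hmem, by rw [hq]; simp⟩), hkill⟩

end Perturbation

section Induction

/-- `X` consists of 2-squares at distinct points, imposing independent conditions on forms of
degree `d`. -/
def IsIndependent (X : List Sq) (d : ℕ) : Prop :=
  (X.map Sq.point).Nodup ∧ Module.finrank ℂ (forms X d) + 4 * X.length ≤ formDim d

lemma IsIndependent.tail {q : Sq} {X : List Sq} {d : ℕ} (h : IsIndependent (q :: X) d) :
    IsIndependent X d := by
  obtain ⟨h1, h2⟩ := h
  refine ⟨h1.of_cons, ?_⟩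
  have := finrank_forms_cons_ge q X d
  simp only [List.length_cons] at h2
  omega

lemma IsIndependent.exists_of_le {X : List Sq} {d s : ℕ} (h : IsIndependent X d)
    (hs : s ≤ X.length) : ∃ Y, IsIndependent Y d ∧ Y.length = s := by
  induction X with
  | nil => exact ⟨[], h, (Nat.le_zero.mp hs).symm⟩
  | cons q X ih =>
    rcases hs.eq_or_lt with rfl | hlt
    · exact ⟨_, h, rfl⟩
    · exact ih h.tail (Nat.lt_succ_iff.mp hlt)

lemma IsIndependent.finrank_forms {X : List Sq} {d : ℕ} (h : IsIndependent X d) :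
    Module.finrank ℂ (forms X d) + 4 * X.length = formDim d :=
  h.2.antisymm (formDim_le_finrank_forms_add X d)

lemma exists_forall_ne_a (X : List Sq) (F : Set ℂ) (hF : F.Finite) :
    ∃ c ∉ F, ∀ q ∈ X, q.a ≠ c := by
  obtain ⟨c, hc⟩ := (hF.union (List.finite_toSet (X.map Sq.a))).exists_notMem
  simp only [Set.mem_union, not_or] at hc
  exact ⟨c, hc.1, fun q hq h => hc.2 (List.mem_map.mpr ⟨q, hq, h⟩)⟩

/-- One 2-square killing the residual system may be added next to a full line of adapted
2-squares. -/
lemma exists_sq_of_finrank_le_three_of_line {X : List Sq} {k : ℕ} {c : ℂ}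
    (hc : ∀ q ∈ X, q.a ≠ c) (hrank : Module.finrank ℂ (forms X (2 * k)) ≤ 3)
    (hU : ∀ h ∈ forms X (2 * k), restrict c h = 0 → h = 0) {F : Set (ℂ × ℂ)} (hF : F.Finite) :
    ∃ q : Sq, q.point ∉ F ∧
      ∀ f ∈ forms (lineSquares c 0 (k + 1) ++ X) (2 * k + 2), q.conditions f = 0 → f = 0 := by
  by_cases hall : ∀ f ∈ forms (lineSquares c 0 (k + 1) ++ X) (2 * k + 2),
      f.coeff (Finsupp.single 1 (2 * k + 2)) = 0
  · refine exists_sq_of_finrank_le_three _ (fun f hf => (mem_forms.mp hf).1)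
      (le_trans ?_ hrank) hF
    exact finrank_le_of_forall_exists _ _ (LinearMap.mulLeft ℂ (vline c ^ 2))
      fun f hf => exists_mem_forms_of_even hc hf (hall f hf)
  · push Not at hall
    obtain ⟨f₀, hf₀, hne⟩ := hall
    refine exists_sq_of_perturbation (c := c) (f₀ := f₀) ?_ _ _ hrank hU ?_ hF
    · intro h0
      rw [← coeff_restrict (mem_forms.mp hf₀).1 c, h0] at hne
      simp at hne
    · intro f hf
      set r := f.coeff (Finsupp.single 1 (2 * k + 2)) / f₀.coeff (Finsupp.single 1 (2 * k + 2))
      obtain ⟨h, hh, heq⟩ := exists_mem_forms_of_even hc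
        (sub_mem hf (Submodule.smul_mem _ r hf₀)) (by
          rw [coeff_sub, coeff_smul, smul_eq_mul, div_mul_cancel₀ _ hne, sub_self])
      exact ⟨r, h, hh, by rw [C_mul', ← heq]; ring⟩

lemma exists_isIndependent_even (k : ℕ) :
    ∃ (X : List Sq) (c : ℂ), IsIndependent X (2 * k) ∧ X.length = formDim (2 * k) / 4 ∧
      (∀ q ∈ X, q.a ≠ c) ∧ ∀ f ∈ forms X (2 * k), restrict c f = 0 → f = 0 := by
  induction k with
  | zero =>
    refine ⟨[], 0, ⟨by simp, ?_⟩, by simp [formDim], by simp, fun f hf h0 => ?_⟩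
    · rw [forms_nil, finrank_homogeneousSubmodule]
      simp
    · have hhom := (mem_forms.mp hf).1
      rw [mul_zero] at hhom
      obtain ⟨r, rfl⟩ : ∃ r, f = C r := ⟨_, totalDegree_eq_zero_iff_eq_C.mp
        (Nat.le_zero.mp hhom.totalDegree_le)⟩
      simpa [restrict] using h0
  | succ k ih =>
    obtain ⟨X, c, hX, hlen, hc, hU⟩ := ih
    have hdim : formDim (2 * (k + 1)) = formDim (2 * k) + 4 * (k + 1) + 1 := by
      rw [mul_add_one, formDim_add_two]
      ring
    have hrank := hX.finrank_forms
    rw [mul_add_one] at hdim ⊢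
    by_cases hmod : formDim (2 * k) % 4 = 3
    · obtain ⟨q, hq, hkill⟩ := exists_sq_of_finrank_le_three_of_line hc (by omega) hU
        (List.finite_toSet ((lineSquares c 0 (k + 1) ++ X).map Sq.point))
      have hbot : ∀ f ∈ forms (q :: (lineSquares c 0 (k + 1) ++ X)) (2 * k + 2), f = 0 := by
        intro f hf
        rw [forms_cons] at hf
        exact hkill f hf.1 hf.2
      obtain ⟨c', -, hc'⟩ := exists_forall_ne_a (q :: (lineSquares c 0 (k + 1) ++ X)) ∅
        Set.finite_empty
      refine ⟨q :: (lineSquares c 0 (k + 1) ++ X), c', ⟨?_, ?_⟩, ?_, hc', fun f hf _ => hbot f hf⟩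
      · rw [List.map_cons, List.nodup_cons]
        exact ⟨hq, nodup_lineSquares_append hX.1 hc _ _⟩
      · rw [(Submodule.eq_bot_iff _).mpr hbot, finrank_bot]
        simp only [List.length_cons, List.length_append, length_lineSquares]
        omega
      · simp only [List.length_cons, List.length_append, length_lineSquares]
        omega
    · obtain ⟨c₀, hne, hc₀⟩ := exists_forall_ne_a X {c} (Set.finite_singleton c)
      refine ⟨lineSquares c₀ 0 (k + 1) ++ X, c, ⟨nodup_lineSquares_append hX.1 hc₀ _ _, ?_⟩, ?_,
        ?_, ?_⟩
      · have := finrank_forms_lineSquares_append_le (k := k) 0 hc₀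
        simp only [List.length_append, length_lineSquares]
        omega
      · simp only [List.length_append, length_lineSquares]
        omega
      · intro q hq
        rcases List.mem_append.mp hq with hq | hq
        · rw [a_eq_of_mem_lineSquares hq]
          simpa using hne
        · exact hc q hq
      · intro f hf h0
        obtain ⟨h, hh, rfl⟩ := exists_mem_forms_of_even hc₀ hf (by
          rw [← coeff_restrict (mem_forms.mp hf).1 c, h0, Polynomial.coeff_zero])
        rw [map_mul, map_pow, mul_eq_zero] at h0
        have hv : restrict c (vline c₀) ≠ 0 := by
          have : restrict c (vline c₀) = Polynomial.C (c - c₀) := by simp [restrict, vline]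
          rw [this, Polynomial.C_ne_zero, sub_ne_zero]
          exact fun h => hne h.symm
        rw [hU h hh (h0.resolve_left (pow_ne_zero 2 hv)), mul_zero]

/-- A space of forms contains a form not vanishing at a general point, unless it is zero. -/
lemma exists_finrank_inf_ker_lt (X : List Sq) (d : ℕ) :
    ∃ c b : ℂ, (∀ q ∈ X, q.a ≠ c) ∧
      ∀ W : Submodule ℂ TernaryRing, W ≤ forms X d → (∀ h ∈ W, eval ![c, b, 1] h = 0) →
        Module.finrank ℂ W ≤ Module.finrank ℂ (forms X d) - 1 := by
  by_cases hbot : forms X d = ⊥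
  · obtain ⟨c, -, hc⟩ := exists_forall_ne_a X ∅ Set.finite_empty
    refine ⟨c, 0, hc, fun W hW _ => ?_⟩
    rw [hbot, le_bot_iff] at hW
    rw [hW, finrank_bot]
    exact Nat.zero_le _
  obtain ⟨h₀, hh₀, hne⟩ := Submodule.exists_mem_ne_zero_of_ne_bot hbot
  have hprod : h₀ * (X.map fun q => vline q.a).prod ≠ 0 := by
    refine mul_ne_zero hne (List.prod_ne_zero ?_)
    simp only [List.mem_map, not_exists, not_and]
    exact fun q _ => vline_ne_zero q.a
  have hhom : (h₀ * (X.map fun q => vline q.a).prod).IsHomogeneous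
      (d + (X.map fun _ => 1).sum) := by
    refine (mem_forms.mp hh₀).1.mul ?_
    clear hprod hne hh₀ hbot
    induction X with
    | nil => simpa using isHomogeneous_one (Fin 3) ℂ
    | cons q X ih => simpa using (isHomogeneous_vline q.a).mul ih
  obtain ⟨c, b, hcb⟩ : ∃ c b, eval ![c, b, 1] (h₀ * (X.map fun q => vline q.a).prod) ≠ 0 := by
    by_contra! hall
    exact hprod (eq_zero_of_eval_chart hhom hall)
  rw [map_mul] at hcb
  refine ⟨c, b, fun q hq hqc => right_ne_zero_of_mul hcb ?_, fun W hW hvan => ?_⟩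
  · rw [map_list_prod, List.map_map]
    refine List.prod_eq_zero (List.mem_map.mpr ⟨q, hq, ?_⟩)
    simp [vline, hqc]
  · have hlt : W < forms X d := lt_of_le_of_ne hW fun heq =>
      left_ne_zero_of_mul hcb (hvan h₀ (heq ▸ hh₀))
    have := Submodule.finrank_lt_finrank_of_lt hlt
    omega

lemma exists_isIndependent_odd (k : ℕ) :
    ∃ X : List Sq, IsIndependent X (2 * k + 1) ∧ X.length = formDim (2 * k + 1) / 4 := by
  induction k with
  | zero =>
    refine ⟨[], ⟨by simp, ?_⟩, by simp [formDim]⟩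
    rw [forms_nil, finrank_homogeneousSubmodule]
    simp
  | succ k ih =>
    obtain ⟨X₀, hX₀, hlen₀⟩ := ih
    obtain ⟨X, hX, hlen⟩ := hX₀.exists_of_le (s := (formDim (2 * k + 1) - 1) / 4) (by omega)
    have hpos : 1 ≤ formDim (2 * k + 1) := by
      rw [formDim, Nat.one_le_div_iff two_pos]
      nlinarith
    have hdim : formDim (2 * k + 3) + 1 = formDim (2 * k + 1) + 4 * (k + 2) := by
      rw [show 2 * k + 3 = 2 * k + 1 + 2 by ring, formDim_add_two]
      ring
    obtain ⟨c, b, hc, hcb⟩ := exists_finrank_inf_ker_lt X (2 * k + 1)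
    have hrank := hX.finrank_forms
    rw [show 2 * (k + 1) + 1 = 2 * k + 3 by ring]
    refine ⟨Sq.skew c b :: (lineSquares c b (k + 1) ++ X), ⟨?_, ?_⟩, ?_⟩
    · rw [List.map_cons, List.nodup_cons]
      exact ⟨point_skew_notMem hc b _, nodup_lineSquares_append hX.1 hc _ _⟩
    · let W : Submodule ℂ TernaryRing :=
        forms X (2 * k + 1) ⊓ LinearMap.ker (aeval ![c, b, 1] : TernaryRing →ₐ[ℂ] ℂ).toLinearMap
      have hW := hcb W inf_le_left fun h hh => by
        simpa [aeval_eq_eval] using LinearMap.mem_ker.mp hh.2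
      have : FiniteDimensional ℂ W := Submodule.finiteDimensional_inf_left _ _
      have hle := finrank_le_of_forall_exists
        (forms (Sq.skew c b :: (lineSquares c b (k + 1) ++ X)) (2 * k + 3)) W
        (LinearMap.mulLeft ℂ (vline c ^ 2)) fun f hf => by
          obtain ⟨h, hh, h0, rfl⟩ := exists_mem_forms_of_odd hc hf
          exact ⟨h, ⟨hh, by simpa [aeval_eq_eval] using h0⟩, rfl⟩
      simp only [List.length_cons, List.length_append, length_lineSquares]
      omega
    · simp only [List.length_cons, List.length_append, length_lineSquares]
      omega

lemma exists_isIndependent (d : ℕ) :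
    ∃ X : List Sq, IsIndependent X d ∧ X.length = formDim d / 4 := by
  obtain ⟨k, rfl | rfl⟩ := Nat.even_or_odd' d
  · obtain ⟨X, -, hX, hlen, -⟩ := exists_isIndependent_even k
    exact ⟨X, hX, hlen⟩
  · exact exists_isIndependent_odd k

/-- Every number of 2-squares has good postulation for a suitable choice of the 2-squares. -/
lemma exists_finrank_forms_eq (d s : ℕ) :
    ∃ X : List Sq, (X.map Sq.point).Nodup ∧ X.length = s ∧
      Module.finrank ℂ (forms X d) = formDim d - 4 * s := by
  obtain ⟨X₀, hX₀, hlen₀⟩ := exists_isIndependent d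
  have hrank₀ := hX₀.finrank_forms
  rcases le_or_gt s (formDim d / 4) with hs | hs
  · obtain ⟨X, hX, rfl⟩ := hX₀.exists_of_le (hlen₀ ▸ hs)
    exact ⟨X, hX.1, rfl, by have := hX.finrank_forms; omega⟩
  · suffices h : ∃ X : List Sq, (X.map Sq.point).Nodup ∧ X.length = s ∧ forms X d = ⊥ by
      obtain ⟨X, hX, hlen, hbot⟩ := h
      exact ⟨X, hX, hlen, by rw [hbot, finrank_bot]; omega⟩
    induction s, hs using Nat.le_induction with
    | base =>
      obtain ⟨q, hq, hkill⟩ := exists_sq_of_finrank_le_three (forms X₀ d)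
        (fun f hf => (mem_forms.mp hf).1) (by omega)
        (List.finite_toSet (X₀.map Sq.point))
      refine ⟨q :: X₀, ?_, by simp [hlen₀], ?_⟩
      · rw [List.map_cons, List.nodup_cons]
        exact ⟨hq, hX₀.1⟩
      · rw [forms_cons, Submodule.eq_bot_iff]
        exact fun f hf => hkill f hf.1 hf.2
    | succ s _ ih =>
      obtain ⟨X, hX, hlen, hbot⟩ := ih
      obtain ⟨c, -, hc⟩ := exists_forall_ne_a X ∅ Set.finite_empty
      refine ⟨Sq.adapted c 0 :: X, ?_, by simp [hlen], ?_⟩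
      · rw [List.map_cons, List.nodup_cons]
        refine ⟨fun hmem => ?_, hX⟩
        obtain ⟨q, hq, h⟩ := List.mem_map.mp hmem
        exact hc q hq (congrArg Prod.fst h)
      · rw [forms_cons, hbot, bot_inf_eq]

end Induction

section Forms

lemma Sq.linearIndependent_forms (q : Sq) : LinearIndependent ℂ ![q.form₁, q.form₂] := by
  rw [LinearIndependent.pair_iff]
  intro r s h
  have h0 := congrArg (fun f => eval ![q.a, q.b, 1] (pderiv 0 f)) h
  have h1 := congrArg (fun f => eval ![q.a, q.b, 1] (pderiv 1 f)) h
  simp [smul_eval] at h0 h1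
  constructor
  · refine (mul_eq_zero.mp (?_ : (q.u₁ * q.v₂ - q.u₂ * q.v₁) * r = 0)).resolve_left q.det_ne_zero
    linear_combination q.u₁ * h0 + q.u₂ * h1
  · refine (mul_eq_zero.mp (?_ : (q.u₁ * q.v₂ - q.u₂ * q.v₁) * s = 0)).resolve_left q.det_ne_zero
    linear_combination q.v₁ * h0 + q.v₂ * h1

lemma Sq.eq_of_eval_forms_eq_zero (q : Sq) {p : Fin 3 → ℂ} (h₁ : eval p q.form₁ = 0)
    (h₂ : eval p q.form₂ = 0) : p 0 = q.a * p 2 ∧ p 1 = q.b * p 2 := by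
  simp [Sq.form₁, Sq.form₂] at h₁ h₂
  constructor
  · refine sub_eq_zero.mp ((mul_eq_zero.mp
      (?_ : (q.u₁ * q.v₂ - q.u₂ * q.v₁) * _ = 0)).resolve_left q.det_ne_zero)
    linear_combination q.u₁ * h₁ + q.v₁ * h₂
  · refine sub_eq_zero.mp ((mul_eq_zero.mp
      (?_ : (q.u₁ * q.v₂ - q.u₂ * q.v₁) * _ = 0)).resolve_left q.det_ne_zero)
    linear_combination q.u₂ * h₁ + q.v₂ * h₂

lemma Sq.point_eq_of_common_zero {q q' : Sq} {p : Fin 3 → ℂ} (hp : p ≠ 0)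
    (h₁ : eval p q.form₁ = 0) (h₂ : eval p q.form₂ = 0) (h₁' : eval p q'.form₁ = 0)
    (h₂' : eval p q'.form₂ = 0) : q.point = q'.point := by
  obtain ⟨ha, hb⟩ := q.eq_of_eval_forms_eq_zero h₁ h₂
  obtain ⟨ha', hb'⟩ := q'.eq_of_eval_forms_eq_zero h₁' h₂'
  have h2 : p 2 ≠ 0 := by
    intro h0
    apply hp
    ext i
    fin_cases i <;> simp [ha, hb, h0]
  exact Prod.ext (mul_right_cancel₀ h2 (ha.symm.trans ha'))
    (mul_right_cancel₀ h2 (hb.symm.trans hb'))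

end Forms

end TwoSquare

/-- A general union of `s` 2-squares in `ℙ²` has good postulation. -/
theorem stmt_1 (s d : ℕ) (hs : 1 ≤ s) (hd : 1 ≤ d) :
    ∃ L : Fin s → Fin 2 → MvPolynomial (Fin 3) ℂ,
      (∀ i j, (L i j).IsHomogeneous 1) ∧
      (∀ i, LinearIndependent ℂ (L i)) ∧
      (∀ i j, i ≠ j →
        ∀ p : Fin 3 → ℂ, p ≠ 0 →
          ¬ (eval p (L i 0) = 0 ∧ eval p (L i 1) = 0 ∧
             eval p (L j 0) = 0 ∧ eval p (L j 1) = 0)) ∧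
      (hdim (⨅ i, Ideal.span {(L i 0) ^ 2, (L i 1) ^ 2}) d : ℤ) =
        max 0 (((d : ℤ) + 2) * ((d : ℤ) + 1) / 2 - 4 * (s : ℤ)) := by
  obtain ⟨X, hX, rfl, hrank⟩ := TwoSquare.exists_finrank_forms_eq d s
  refine ⟨fun i => ![(X.get i).form₁, (X.get i).form₂], fun i j => ?_,
    fun i => (X.get i).linearIndependent_forms, fun i j hij p hp h => hij ?_, ?_⟩
  · fin_cases j
    · exact (X.get i).isHomogeneous_form₁
    · exact (X.get i).isHomogeneous_form₂
  · have hpt := TwoSquare.Sq.point_eq_of_common_zero hp h.1 h.2.1 h.2.2.1 h.2.2.2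
    have hinj := List.nodup_iff_injective_get.mp hX
    have := @hinj (i.cast (by simp)) (j.cast (by simp)) (by simpa using hpt)
    simpa [Fin.ext_iff] using this
  · have hforms := TwoSquare.restrictScalars_iInf_ideal_inf X d
    have : hdim (⨅ i : Fin X.length, Ideal.span {(X.get i).form₁ ^ 2, (X.get i).form₂ ^ 2}) d =
        TwoSquare.formDim d - 4 * X.length := by
      rw [← hrank, ← hforms]
      rfl
    have hdim : ((d : ℤ) + 2) * ((d : ℤ) + 1) / 2 = (TwoSquare.formDim d : ℤ) := by
      simp [TwoSquare.formDim]
    simp only [Matrix.cons_val_zero, Matrix.cons_val_one]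
    rw [this, hdim]
    omega
end

section
/- For each d ∈ {2,4} and each integer s ≥ 1, there exist linear forms L_{i,1}, L_{i,2} ∈ ℂ[x,y,z] (1 ≤ i ≤ s), with L_{i,1}, L_{i,2} linearly independent for each i and with the s common zero points in ℙ² pairwise distinct, such that dim_ℂ ( ⋂_{i=1}^{s} (L_{i,1}², L_{i,2}²) )_d = max{0, (d+2)(d+1)/2 − 4s}. -/
open MvPolynomial

/-- The exponents of degree `d` in three variables that are divisible by the square of one of the
two variables `(c i).1`, `(c i).2`, for every `i`. -/
def squareExponents {ι : Type*} [Fintype ι] (c : ι → Fin 3 × Fin 3) (d : ℕ) :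
    Finset (Fin 3 → ℕ) :=
  (Finset.Nat.antidiagonalTuple 3 d).filter fun f => ∀ i, 2 ≤ f (c i).1 ∨ 2 ≤ f (c i).2

theorem mem_span_X_sq_pair {σ R : Type*} [CommRing R] (a b : σ) (F : MvPolynomial σ R) :
    F ∈ Ideal.span {(X a : MvPolynomial σ R) ^ 2, X b ^ 2} ↔
      ∀ m ∈ F.support, 2 ≤ m a ∨ 2 ≤ m b := by
  have h : ({(X a : MvPolynomial σ R) ^ 2, X b ^ 2} : Set (MvPolynomial σ R)) =
      (fun s => monomial s (1 : R)) '' {Finsupp.single a 2, Finsupp.single b 2} := by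
    simp [Set.image_pair, X_pow_eq_monomial]
  simp [h, mem_ideal_span_monomial_image]

theorem iInf_inf_homogeneousSubmodule_eq {ι : Type*} [Fintype ι] (c : ι → Fin 3 × Fin 3) (d : ℕ) :
    (Submodule.restrictScalars ℂ
        (⨅ i, Ideal.span {(X (c i).1 : MvPolynomial (Fin 3) ℂ) ^ 2, X (c i).2 ^ 2}) ⊓
      homogeneousSubmodule (Fin 3) ℂ d : Submodule ℂ (MvPolynomial (Fin 3) ℂ)) =
    restrictSupport ℂ
      ((squareExponents c d).map Finsupp.equivFunOnFinite.symm.toEmbedding : Set (Fin 3 →₀ ℕ)) := by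
  ext F
  simp only [Submodule.mem_inf, Submodule.restrictScalars_mem, Submodule.mem_iInf,
    mem_span_X_sq_pair, homogeneousSubmodule_eq_finsupp_supported, restrictSupport,
    AddMonoidAlgebra.mem_supported]
  have h (m : Fin 3 →₀ ℕ) :
      m ∈ (squareExponents c d).map Finsupp.equivFunOnFinite.symm.toEmbedding ↔
        m.degree = d ∧ ∀ i, 2 ≤ m (c i).1 ∨ 2 ≤ m (c i).2 := by
    simp [squareExponents, Finset.Nat.mem_antidiagonalTuple, Finsupp.degree_eq_sum,
      Finset.mem_map_equiv]
  simp only [Set.subset_def, Finset.mem_coe, h, Set.mem_ofPred_eq]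
  exact ⟨fun ⟨h1, h2⟩ m hm => ⟨h2 m hm, fun i => h1 i m hm⟩,
    fun h => ⟨fun i m hm => (h m hm).2 i, fun m hm => (h m hm).1⟩⟩

theorem hdim_iInf_span_X_sq {ι : Type*} [Fintype ι] (c : ι → Fin 3 × Fin 3) (d : ℕ) :
    hdim (⨅ i, Ideal.span {(X (c i).1 : MvPolynomial (Fin 3) ℂ) ^ 2, X (c i).2 ^ 2}) d =
      (squareExponents c d).card := by
  rw [hdim, iInf_inf_homogeneousSubmodule_eq,
    Module.finrank_eq_nat_card_basis (basisRestrictSupport ℂ _)]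
  rw [Nat.card_coe_set_eq, Set.ncard_coe_finset, Finset.card_map]

theorem eval_pderiv_eq_zero_of_mem_span_sq_pair {σ R : Type*} [CommRing R] {p : σ → R}
    {A B F : MvPolynomial σ R} (hA : eval p A = 0) (hB : eval p B = 0)
    (hF : F ∈ Ideal.span {A ^ 2, B ^ 2}) (k : σ) : eval p (pderiv k F) = 0 := by
  obtain ⟨u, v, rfl⟩ := Ideal.mem_span_pair.1 hF
  simp [Derivation.leibniz, Derivation.leibniz_pow, hA, hB]

/-- At the point `(1, …, 1)` the partial derivatives of a form are read off its coefficients. -/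
theorem eval_one_pderiv_eq_sum {σ R : Type*} [CommRing R] [Finite σ] (F : MvPolynomial σ R)
    (S : Finset (σ → ℕ)) (hF : F ∈ restrictSupport R
      (S.map Finsupp.equivFunOnFinite.symm.toEmbedding : Set (σ →₀ ℕ))) (k : σ) :
    eval 1 (pderiv k F) = ∑ f ∈ S, coeff (Finsupp.equivFunOnFinite.symm f) F * f k := by
  have h : F.support ⊆ S.map Finsupp.equivFunOnFinite.symm.toEmbedding := by
    exact_mod_cast (mem_restrictSupport_iff R).1 hF
  have h2 : F = ∑ m ∈ S.map Finsupp.equivFunOnFinite.symm.toEmbedding, monomial m (coeff m F) := by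
    conv_lhs => rw [F.as_sum]
    refine Finset.sum_subset h fun m _ hm => ?_
    simp_all
  conv_lhs => rw [h2]
  simp [pderiv_monomial, eval_monomial]

theorem linearIndependent_of_eval {σ K : Type*} [Field K] {A B : MvPolynomial σ K} (p q : σ → K)
    (hAp : eval p A ≠ 0) (hBp : eval p B = 0) (hAq : eval q A = 0) (hBq : eval q B ≠ 0) :
    LinearIndependent K ![A, B] := by
  rw [LinearIndependent.pair_iff]
  intro s t h
  have hp := congrArg (eval p) h
  have hq := congrArg (eval q) h
  simp only [map_add, smul_eval, map_zero] at hp hq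
  simp_all

/-- The forms cutting out the points `(n, n, 1)`. -/
noncomputable def diagonalForms (n : ℕ) : Fin 2 → MvPolynomial (Fin 3) ℂ :=
  ![X 0 - C (n : ℂ) * X 2, X 1 - C (n : ℂ) * X 2]

/-- The forms cutting out the three coordinate points, followed by the points `(1, n, 1)` with
`1 ≤ n`. -/
noncomputable def coordinateForms : ℕ → Fin 2 → MvPolynomial (Fin 3) ℂ
  | 0 => ![X 0, X 1]
  | 1 => ![X 0, X 2]
  | 2 => ![X 1, X 2]
  | n + 3 => ![X 0 - X 2, X 1 - C ((n : ℂ) + 1) * X 2]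

theorem hdim_eq_zero_of_forall {I : Ideal (MvPolynomial (Fin 3) ℂ)} {d : ℕ}
    (h : ∀ F ∈ I, F.IsHomogeneous d → F = 0) : hdim I d = 0 := by
  have hbot : Submodule.restrictScalars ℂ I ⊓ homogeneousSubmodule (Fin 3) ℂ d = ⊥ :=
    (Submodule.eq_bot_iff _).2 fun F hF => h F (Submodule.mem_inf.1 hF).1 (Submodule.mem_inf.1 hF).2
  rw [hdim, hbot, finrank_bot]

theorem eq_zero_of_coeff_eq_zero {σ R : Type*} [CommRing R] [Finite σ] {F : MvPolynomial σ R}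
    {S : Finset (σ → ℕ)} (hF : F ∈ restrictSupport R
      (S.map Finsupp.equivFunOnFinite.symm.toEmbedding : Set (σ →₀ ℕ)))
    (h : ∀ f ∈ S, coeff (Finsupp.equivFunOnFinite.symm f) F = 0) : F = 0 := by
  ext m
  by_contra hm
  have : m ∈ S.map Finsupp.equivFunOnFinite.symm.toEmbedding :=
    (mem_restrictSupport_iff R).1 hF (mem_support_iff.2 hm)
  obtain ⟨f, hf, rfl⟩ := Finset.mem_map.1 this
  exact hm (h f hf)

theorem hdim_diagonalForms_one :
    hdim (⨅ i : Fin 1, Ideal.span {(diagonalForms i 0) ^ 2, (diagonalForms i 1) ^ 2}) 2 = 2 := by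
  have h := hdim_iInf_span_X_sq (fun _ : Fin 1 => (0, 1)) 2
  rw [show (squareExponents (fun _ : Fin 1 => (0, 1)) 2).card = 2 by decide] at h
  simpa [diagonalForms] using h

theorem hdim_diagonalForms_of_two_le {s : ℕ} (hs : 2 ≤ s) :
    hdim (⨅ i : Fin s, Ideal.span {(diagonalForms i 0) ^ 2, (diagonalForms i 1) ^ 2}) 2 = 0 := by
  refine hdim_eq_zero_of_forall fun F hF hd => ?_
  rw [Submodule.mem_iInf] at hF
  have h0 := hF ⟨0, by omega⟩
  have h1 := hF ⟨1, by omega⟩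
  have hR : F ∈ restrictSupport ℂ _ := (iInf_inf_homogeneousSubmodule_eq
    (fun _ : Fin 1 => (0, 1)) 2).le ⟨by simpa [diagonalForms] using h0, hd⟩
  have hk k := (eval_one_pderiv_eq_sum F _ hR k).symm.trans
    (eval_pderiv_eq_zero_of_mem_span_sq_pair (by simp [diagonalForms]) (by simp [diagonalForms])
      h1 k)
  refine eq_zero_of_coeff_eq_zero hR ?_
  rw [show squareExponents (fun _ : Fin 1 => ((0 : Fin 3), (1 : Fin 3))) 2 =
    {![2, 0, 0], ![0, 2, 0]} by decide] at hk ⊢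
  have e0 := hk 0
  have e1 := hk 1
  rw [Finset.sum_pair (by decide)] at e0 e1
  simp_all

/-- The pairs of variables vanishing at the three coordinate points. -/
def coordinatePairs : Fin 3 → Fin 3 × Fin 3 := ![(0, 1), (0, 2), (1, 2)]

theorem coordinateForms_eq_X (i : Fin 3) :
    coordinateForms i = ![X (coordinatePairs i).1, X (coordinatePairs i).2] := by
  fin_cases i <;> rfl

theorem hdim_coordinateForms_of_le_three {s : ℕ} (hs : s ≤ 3) :
    hdim (⨅ i : Fin s, Ideal.span {(coordinateForms i 0) ^ 2, (coordinateForms i 1) ^ 2}) 4 =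
      15 - 4 * s := by
  have hc : (squareExponents (fun i : Fin s => coordinatePairs (i.castLE hs)) 4).card =
      15 - 4 * s := by
    interval_cases s <;> decide +revert
  have e (i : Fin s) : coordinateForms i = _ := coordinateForms_eq_X (i.castLE hs)
  simp only [e]
  exact (hdim_iInf_span_X_sq _ 4).trans hc

theorem hdim_coordinateForms_of_four_le {s : ℕ} (hs : 4 ≤ s) :
    hdim (⨅ i : Fin s, Ideal.span {(coordinateForms i 0) ^ 2, (coordinateForms i 1) ^ 2}) 4 =
      0 := by
  refine hdim_eq_zero_of_forall fun F hF hd => ?_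
  rw [Submodule.mem_iInf] at hF
  have h3 := hF ⟨3, by omega⟩
  have hI : F ∈ ⨅ i : Fin 3, Ideal.span {(X (coordinatePairs i).1 : MvPolynomial (Fin 3) ℂ) ^ 2,
      X (coordinatePairs i).2 ^ 2} := by
    rw [Submodule.mem_iInf]
    intro i
    have h := hF (i.castLE (by omega))
    rwa [Fin.val_castLE, coordinateForms_eq_X] at h
  have hR : F ∈ restrictSupport ℂ _ := (iInf_inf_homogeneousSubmodule_eq _ 4).le ⟨hI, hd⟩
  have hk k := (eval_one_pderiv_eq_sum F _ hR k).symm.trans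
    (eval_pderiv_eq_zero_of_mem_span_sq_pair (by simp [coordinateForms])
      (by simp [coordinateForms]) h3 k)
  refine eq_zero_of_coeff_eq_zero hR ?_
  rw [show squareExponents coordinatePairs 4 =
    {![2, 2, 0], ![2, 0, 2], ![0, 2, 2]} by decide] at hk ⊢
  have e0 := hk 0
  have e1 := hk 1
  have e2 := hk 2
  rw [Finset.sum_insert (by decide), Finset.sum_pair (by decide)] at e0 e1 e2
  simp only [Finset.mem_insert, Finset.mem_singleton, forall_eq_or_imp, forall_eq]
  simp at e0 e1 e2
  refine ⟨?_, ?_, ?_⟩ <;> grind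

theorem isHomogeneous_diagonalForms (n : ℕ) (j : Fin 2) :
    (diagonalForms n j).IsHomogeneous 1 := by
  fin_cases j
  all_goals exact (isHomogeneous_X _ _).sub (isHomogeneous_C_mul_X _ _)

theorem isHomogeneous_coordinateForms (n : ℕ) (j : Fin 2) :
    (coordinateForms n j).IsHomogeneous 1 := by
  match n with
  | 0 | 1 | 2 => fin_cases j <;> simp [coordinateForms, isHomogeneous_X]
  | n + 3 =>
    fin_cases j
    · exact (isHomogeneous_X _ _).sub (isHomogeneous_X _ _)
    · exact (isHomogeneous_X _ _).sub (isHomogeneous_C_mul_X _ _)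

theorem linearIndependent_diagonalForms (n : ℕ) : LinearIndependent ℂ (diagonalForms n) :=
  linearIndependent_of_eval ![1, 0, 0] ![0, 1, 0] (by simp) (by simp) (by simp) (by simp)

theorem linearIndependent_coordinateForms (n : ℕ) : LinearIndependent ℂ (coordinateForms n) := by
  match n with
  | 0 =>
    exact linearIndependent_of_eval ![1, 0, 0] ![0, 1, 0]
      (by simp) (by simp) (by simp) (by simp)
  | 1 =>
    exact linearIndependent_of_eval ![1, 0, 0] ![0, 0, 1]
      (by simp) (by simp) (by simp) (by simp)
  | 2 =>
    exact linearIndependent_of_eval ![0, 1, 0] ![0, 0, 1]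
      (by simp) (by simp) (by simp) (by simp)
  | n + 3 =>
    exact linearIndependent_of_eval ![1, 0, 0] ![0, 1, 0]
      (by simp) (by simp) (by simp) (by simp)

theorem eq_zero_of_eval_diagonalForms {m n : ℕ} (hmn : m ≠ n) {p : Fin 3 → ℂ}
    (hm : ∀ j, eval p (diagonalForms m j) = 0) (hn : ∀ j, eval p (diagonalForms n j) = 0) :
    p = 0 := by
  have hmn' : (m : ℂ) ≠ n := by exact_mod_cast hmn
  simp only [diagonalForms, Fin.forall_fin_two, Matrix.cons_val_zero, Matrix.cons_val_one,
    map_sub, map_mul, eval_X, eval_C] at hm hn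
  have h2 : p 2 = 0 := by
    have : ((m : ℂ) - n) * p 2 = 0 := by linear_combination hn.1 - hm.1
    exact (mul_eq_zero.1 this).resolve_left (sub_ne_zero.2 hmn')
  ext k
  fin_cases k <;> simp_all

theorem eq_zero_of_eval_coordinateForms {m n : ℕ} (hmn : m ≠ n) {p : Fin 3 → ℂ}
    (hm : ∀ j, eval p (coordinateForms m j) = 0) (hn : ∀ j, eval p (coordinateForms n j) = 0) :
    p = 0 := by
  wlog hlt : m < n generalizing m n
  · exact this hmn.symm hn hm (by omega)
  have hp : p 0 = 0 ∧ p 1 = 0 ∧ p 2 = 0 := by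
    match m, n with
    | _, 0 => omega
    | 0, 1 | 0, 2 | 1, 2 =>
      simp [coordinateForms, Fin.forall_fin_two] at hm hn
      grind
    | m + 1, 1 => omega
    | m + 2, 2 => omega
    | 0, n + 3 | 1, n + 3 | 2, n + 3 =>
      have : (n : ℂ) + 1 ≠ 0 := by exact_mod_cast n.succ_ne_zero
      simp [coordinateForms, Fin.forall_fin_two] at hm hn
      grind
    | m + 3, n + 3 =>
      have : (m : ℂ) ≠ n := by exact_mod_cast fun h => hmn (by omega)
      simp [coordinateForms, Fin.forall_fin_two] at hm hn
      grind
  ext k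
  fin_cases k <;> simp [hp]

/-- Base cases `d = 2` and `d = 4` of the good postulation of a general union
of `s` 2-squares in `ℙ²`. -/
theorem stmt_3 (d s : ℕ) (hd : d = 2 ∨ d = 4) (hs : 1 ≤ s) :
    ∃ L : Fin s → Fin 2 → MvPolynomial (Fin 3) ℂ,
      (∀ i j, (L i j).IsHomogeneous 1) ∧
      (∀ i, LinearIndependent ℂ (L i)) ∧
      (∀ i j, i ≠ j →
        ∀ p : Fin 3 → ℂ, p ≠ 0 →
          ¬ (eval p (L i 0) = 0 ∧ eval p (L i 1) = 0 ∧
             eval p (L j 0) = 0 ∧ eval p (L j 1) = 0)) ∧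
      (hdim (⨅ i, Ideal.span {(L i 0) ^ 2, (L i 1) ^ 2}) d : ℤ) =
        max 0 (((d : ℤ) + 2) * ((d : ℤ) + 1) / 2 - 4 * (s : ℤ)) := by
  rcases hd with rfl | rfl
  · refine ⟨fun i => diagonalForms i, fun i => isHomogeneous_diagonalForms i,
      fun i => linearIndependent_diagonalForms i, ?_, ?_⟩
    · rintro i j hij p hp ⟨hi0, hi1, hj0, hj1⟩
      exact hp (eq_zero_of_eval_diagonalForms (Fin.val_ne_of_ne hij)
        (Fin.forall_fin_two.2 ⟨hi0, hi1⟩) (Fin.forall_fin_two.2 ⟨hj0, hj1⟩))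
    · rcases hs.eq_or_lt with rfl | hs
      · rw [hdim_diagonalForms_one]
        norm_num
      · rw [hdim_diagonalForms_of_two_le hs]
        omega
  · refine ⟨fun i => coordinateForms i, fun i => isHomogeneous_coordinateForms i,
      fun i => linearIndependent_coordinateForms i, ?_, ?_⟩
    · rintro i j hij p hp ⟨hi0, hi1, hj0, hj1⟩
      exact hp (eq_zero_of_eval_coordinateForms (Fin.val_ne_of_ne hij)
        (Fin.forall_fin_two.2 ⟨hi0, hi1⟩) (Fin.forall_fin_two.2 ⟨hj0, hj1⟩))
    · rcases le_or_gt s 3 with hs | hs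
      · rw [hdim_coordinateForms_of_le_three hs]
        omega
      · rw [hdim_coordinateForms_of_four_le hs]
        omega
end

section
/- Let d ≥ 1 be odd and set e = (d+1)/2. Let a₁, …, a_e ∈ ℂ be pairwise distinct. In S = ℂ[x,y,z] define B = ((x − a₁z − y)², (x − a₁z + y)²) and A_i = ((x − a_i z)², y²) for 2 ≤ i ≤ e, and let J ⊆ S be any homogeneous ideal with J : (y) = J. Then dim_ℂ ( B ∩ A₂ ∩ ⋯ ∩ A_e ∩ J )_d = dim_ℂ ( J ∩ (x − a₁z, y) )_{d−2}. -/
open MvPolynomial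

local notation "x" => (X 0 : MvPolynomial (Fin 3) ℂ)
local notation "y" => (X 1 : MvPolynomial (Fin 3) ℂ)
local notation "z" => (X 2 : MvPolynomial (Fin 3) ℂ)

/-- Restriction to the line `y = 0`, dehomogenised at `z = 1`. -/
noncomputable def restrictLine : MvPolynomial (Fin 3) ℂ →ₐ[ℂ] Polynomial ℂ :=
  aeval ![Polynomial.X, 0, 1]

@[simp] lemma restrictLine_y : restrictLine y = 0 := by simp [restrictLine]

@[simp] lemma restrictLine_linear (a : ℂ) :
    restrictLine (x - C a * z) = Polynomial.X - Polynomial.C a := by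
  simp [restrictLine]

lemma restrictLine_monomial (m : Fin 3 →₀ ℕ) (c : ℂ) :
    restrictLine (monomial m c) = if m 1 = 0 then Polynomial.monomial (m 0) c else 0 := by
  rw [restrictLine, aeval_monomial, Finsupp.prod_fintype _ _ (by simp), Fin.prod_univ_three]
  split_ifs with h
  · simp [h, Polynomial.C_mul_X_pow_eq_monomial]
  · simp [h]

lemma degree_eq_of_isHomogeneous {f : MvPolynomial (Fin 3) ℂ} {n : ℕ} (hf : f.IsHomogeneous n)
    {m : Fin 3 →₀ ℕ} (hm : f.coeff m ≠ 0) : m.degree = n := by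
  rw [← hf hm, Finsupp.degree_eq_weight_one]
  rfl

lemma natDegree_restrictLine_le {f : MvPolynomial (Fin 3) ℂ} {n : ℕ} (hf : f.IsHomogeneous n) :
    (restrictLine f).natDegree ≤ n := by
  rw [f.as_sum, map_sum]
  refine Polynomial.natDegree_sum_le_of_forall_le _ _ fun m hm => ?_
  rw [restrictLine_monomial]
  split_ifs
  · refine (Polynomial.natDegree_monomial_le _).trans ?_
    have h := degree_eq_of_isHomogeneous hf (mem_support_iff.mp hm)
    rw [Finsupp.degree_eq_sum, Fin.sum_univ_three] at h
    omega
  · simp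

lemma coeff_restrictLine {f : MvPolynomial (Fin 3) ℂ} {n : ℕ} (hf : f.IsHomogeneous n)
    {m : Fin 3 →₀ ℕ} (hm : m 1 = 0) (hn : m.degree = n) :
    (restrictLine f).coeff (m 0) = f.coeff m := by
  conv_lhs => rw [f.as_sum, map_sum, Polynomial.finsetSum_coeff]
  rw [Finset.sum_eq_single m]
  · simp [restrictLine_monomial, hm]
  · intro k hk hkm
    rw [restrictLine_monomial]
    split_ifs with h
    · rw [Polynomial.coeff_monomial, if_neg]
      intro h0
      apply hkm
      have h' := degree_eq_of_isHomogeneous hf (mem_support_iff.mp hk)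
      rw [Finsupp.degree_eq_sum, Fin.sum_univ_three] at h'
      rw [Finsupp.degree_eq_sum, Fin.sum_univ_three] at hn
      ext i
      fin_cases i <;> simp <;> omega
    · simp
  · intro h
    simp [notMem_support_iff.mp h]

lemma y_dvd_of_restrictLine_eq_zero {f : MvPolynomial (Fin 3) ℂ} {n : ℕ}
    (hf : f.IsHomogeneous n) (h : restrictLine f = 0) : y ∣ f := by
  rw [X_dvd_iff_modMonomial_eq_zero]
  ext m
  rw [coeff_zero]
  by_cases hm : m 1 = 0
  · rw [coeff_modMonomial_of_not_le]
    · by_contra hc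
      have hd := degree_eq_of_isHomogeneous hf hc
      exact hc (by rw [← coeff_restrictLine hf hm hd, h, Polynomial.coeff_zero])
    · intro hle
      simpa [hm] using hle 1
  · apply coeff_modMonomial_of_le
    rw [Finsupp.single_le_iff]
    omega

/-- A form of degree `n` whose restriction to the line has more than `n` zeros, counted with
multiplicity, vanishes on the line. -/
lemma restrictLine_eq_zero {f : MvPolynomial (Fin 3) ℂ} {n : ℕ} (hf : f.IsHomogeneous n)
    {s : Finset ℕ} {a : ℕ → ℂ} (ha : Set.InjOn a s) (k : ℕ → ℕ)
    (hdvd : ∀ i ∈ s, (Polynomial.X - Polynomial.C (a i)) ^ k i ∣ restrictLine f)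
    (hn : n < ∑ i ∈ s, k i) : restrictLine f = 0 := by
  have hprod : ∏ i ∈ s, (Polynomial.X - Polynomial.C (a i)) ^ k i ∣ restrictLine f := by
    refine Finset.prod_dvd_of_coprime (fun i hi j hj hij => ?_) hdvd
    exact (Polynomial.isCoprime_X_sub_C_of_isUnit_sub
      (sub_ne_zero.mpr fun h => hij (ha hi hj h)).isUnit).pow
  refine Polynomial.eq_zero_of_dvd_of_natDegree_lt hprod ?_
  rw [Polynomial.natDegree_prod_of_monic _ _ fun i _ => (Polynomial.monic_X_sub_C _).pow _]
  simpa using (natDegree_restrictLine_le hf).trans_lt hn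

lemma isHomogeneous_of_X_mul {f : MvPolynomial (Fin 3) ℂ} {i : Fin 3} {n : ℕ}
    (h : (X i * f).IsHomogeneous (n + 1)) : f.IsHomogeneous n := by
  intro m hm
  have := degree_eq_of_isHomogeneous h (m := Finsupp.single i 1 + m) (by rwa [coeff_X_mul])
  rw [map_add, Finsupp.degree_single] at this
  refine Eq.trans ?_ (show m.degree = n by omega)
  rw [Finsupp.degree_eq_weight_one]
  rfl

lemma prime_y : Prime y := X_prime

lemma y_dvd_of_dvd_mul_linear {a : ℂ} {u : MvPolynomial (Fin 3) ℂ}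
    (h : y ∣ u * (x - C a * z)) : y ∣ u := by
  refine (prime_y.dvd_or_dvd h).resolve_right ?_
  rintro ⟨v, hv⟩
  have := congrArg restrictLine hv
  rw [restrictLine_linear, map_mul, restrictLine_y, zero_mul] at this
  exact Polynomial.X_sub_C_ne_zero a this

lemma sq_dvd_restrictLine {a : ℂ} {f : MvPolynomial (Fin 3) ℂ}
    (h : f ∈ Ideal.span {(x - C a * z) ^ 2, y ^ 2}) :
    (Polynomial.X - Polynomial.C a) ^ 2 ∣ restrictLine f := by
  obtain ⟨u, v, rfl⟩ := Ideal.mem_span_pair.mp h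
  simp only [map_add, map_mul, map_pow, restrictLine_linear, restrictLine_y]
  exact ⟨restrictLine u, by ring⟩

lemma sq_dvd_restrictLine_of_y_mul {a : ℂ} {g : MvPolynomial (Fin 3) ℂ}
    (h : y * g ∈ Ideal.span {(x - C a * z) ^ 2, y ^ 2}) :
    (Polynomial.X - Polynomial.C a) ^ 2 ∣ restrictLine g := by
  obtain ⟨u, v, huv⟩ := Ideal.mem_span_pair.mp h
  obtain ⟨w, rfl⟩ : y ∣ u := by
    refine y_dvd_of_dvd_mul_linear (a := a) (y_dvd_of_dvd_mul_linear (a := a) ⟨g - v * y, ?_⟩)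
    linear_combination huv
  have hg : g = w * (x - C a * z) ^ 2 + v * y :=
    mul_left_cancel₀ prime_y.ne_zero (by linear_combination -huv)
  rw [hg]
  simp only [map_add, map_mul, map_pow, restrictLine_linear, restrictLine_y]
  exact ⟨restrictLine w, by ring⟩

lemma sq_dvd_restrictLine_of_symmetric {a : ℂ} {f : MvPolynomial (Fin 3) ℂ}
    (h : f ∈ Ideal.span {(x - C a * z - y) ^ 2, (x - C a * z + y) ^ 2}) :
    (Polynomial.X - Polynomial.C a) ^ 2 ∣ restrictLine f := by
  obtain ⟨u, v, rfl⟩ := Ideal.mem_span_pair.mp h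
  rw [map_add, map_mul, map_mul, map_pow, map_pow, map_sub, map_add restrictLine (_ - _),
    restrictLine_linear, restrictLine_y]
  exact ⟨restrictLine u + restrictLine v, by ring⟩

/-- The residue of a symmetric square with respect to the line. -/
lemma mem_span_of_y_mul_mem_symmetric {a : ℂ} {g : MvPolynomial (Fin 3) ℂ}
    (h : y * g ∈ Ideal.span {(x - C a * z - y) ^ 2, (x - C a * z + y) ^ 2}) :
    g ∈ Ideal.span {x - C a * z, y ^ 2} := by
  obtain ⟨u, v, huv⟩ := Ideal.mem_span_pair.mp h
  obtain ⟨w, hw⟩ : y ∣ u + v := by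
    refine y_dvd_of_dvd_mul_linear (a := a) (y_dvd_of_dvd_mul_linear (a := a)
      ⟨g + (u - v) * (2 * (x - C a * z)) - (u + v) * y, ?_⟩)
    linear_combination huv
  refine Ideal.mem_span_pair.mpr
    ⟨w * (x - C a * z) + 2 * w * y - 4 * u, w, mul_left_cancel₀ prime_y.ne_zero ?_⟩
  linear_combination huv - (x - C a * z + y) ^ 2 * hw

lemma dvd_restrictLine {a : ℂ} {g : MvPolynomial (Fin 3) ℂ}
    (h : g ∈ Ideal.span {x - C a * z, y ^ 2}) :
    Polynomial.X - Polynomial.C a ∣ restrictLine g := by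
  obtain ⟨u, v, rfl⟩ := Ideal.mem_span_pair.mp h
  simp only [map_add, map_mul, map_pow, restrictLine_linear, restrictLine_y]
  exact ⟨restrictLine u, by ring⟩

lemma mem_span_of_y_mul_mem {a : ℂ} {g : MvPolynomial (Fin 3) ℂ}
    (h : y * g ∈ Ideal.span {x - C a * z, y ^ 2}) : g ∈ Ideal.span {x - C a * z, y} := by
  obtain ⟨u, v, huv⟩ := Ideal.mem_span_pair.mp h
  obtain ⟨w, rfl⟩ : y ∣ u := by
    refine y_dvd_of_dvd_mul_linear (a := a) ⟨g - v * y, ?_⟩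
    linear_combination huv
  exact Ideal.mem_span_pair.mpr
    ⟨w, v, mul_left_cancel₀ prime_y.ne_zero (by linear_combination huv)⟩

lemma y_sq_mul_mem_symmetric {a : ℂ} {h : MvPolynomial (Fin 3) ℂ}
    (hh : h ∈ Ideal.span {x - C a * z, y}) :
    y ^ 2 * h ∈ Ideal.span {(x - C a * z - y) ^ 2, (x - C a * z + y) ^ 2} := by
  obtain ⟨u, v, rfl⟩ := Ideal.mem_span_pair.mp hh
  have h4 : (C (1 / 4) * 4 : MvPolynomial (Fin 3) ℂ) = 1 := by
    rw [← map_ofNat C 4, ← C_mul]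
    norm_num
  refine Ideal.mem_span_pair.mpr ⟨C (1 / 4) * (2 * v * y + v * (x - C a * z) - u * y),
    C (1 / 4) * (2 * v * y - v * (x - C a * z) + u * y), ?_⟩
  linear_combination (y ^ 2 * (u * (x - C a * z) + v * y)) * h4

lemma eq_zero_of_isHomogeneous_zero {f : MvPolynomial (Fin 3) ℂ} (hf : f.IsHomogeneous 0)
    (h : restrictLine f = 0) : f = 0 := by
  obtain ⟨c, rfl⟩ : ∃ c, f = C c :=
    ⟨_, totalDegree_eq_zero_iff_eq_C.mp (Nat.le_zero.mp hf.totalDegree_le)⟩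
  have hc : Polynomial.C c = 0 := by
    rw [← h]
    simp [restrictLine]
  rw [Polynomial.C_eq_zero.mp hc, C_0]

lemma eq_zero_of_mem_span_of_isHomogeneous_zero {a : ℂ} {f : MvPolynomial (Fin 3) ℂ}
    (hf : f.IsHomogeneous 0) (h : f ∈ Ideal.span {x - C a * z, y}) : f = 0 := by
  obtain ⟨u, v, huv⟩ := Ideal.mem_span_pair.mp h
  refine eq_zero_of_isHomogeneous_zero hf
    (restrictLine_eq_zero hf (s := {0}) (a := fun _ => a) (by simp) (fun _ => 1) ?_ (by simp))
  intro _ _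
  rw [← huv, map_add, map_mul, map_mul, restrictLine_linear, restrictLine_y]
  exact ⟨restrictLine u, by ring⟩

/-- The Horace lemma for the odd-degree inductive step: `(d+1)/2` 2-squares
specialised on the line `r : y = 0` (one of type (1.b), the rest of type (1.a)),
together with a residual scheme not meeting `r`. -/
theorem stmt_4 (d e : ℕ) (hd : 1 ≤ d) (he : d + 1 = 2 * e)
    (a : ℕ → ℂ) (ha : ∀ i < e, ∀ j < e, a i = a j → i = j)
    (J : Ideal (MvPolynomial (Fin 3) ℂ))
    (hJhom : ∀ f ∈ J, ∀ n : ℕ, homogeneousComponent n f ∈ J)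
    (hJres : J.colon (Ideal.span {y}) = J) :
    hdim ((Ideal.span {(x - C (a 0) * z - y) ^ 2, (x - C (a 0) * z + y) ^ 2}) ⊓
        (⨅ i ∈ Finset.Ico 1 e, Ideal.span {(x - C (a i) * z) ^ 2, y ^ 2}) ⊓ J) d =
      hdim (J ⊓ Ideal.span {x - C (a 0) * z, y}) (d - 2) := by
  have hJ : ∀ f, y * f ∈ J → f ∈ J := fun f hf => by
    rw [← hJres, Submodule.mem_colon]
    intro p hp
    obtain ⟨q, rfl⟩ := Ideal.mem_span_singleton'.mp hp
    rw [smul_eq_mul, show f * (q * y) = q * (y * f) by ring]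
    exact J.mul_mem_left q hf
  have hinj : Set.InjOn a (Finset.range e) := fun i hi j hj =>
    ha i (by simpa using hi) j (by simpa using hj)
  obtain ⟨k, rfl⟩ : ∃ k, e = k + 1 := ⟨e - 1, by omega⟩
  obtain rfl : d = 2 * k + 1 := by omega
  have hrange : Finset.range (k + 1) = insert 0 (Finset.Ico 1 (k + 1)) := by
    ext i
    simp only [Finset.mem_range, Finset.mem_insert, Finset.mem_Ico]
    omega
  let μ := LinearMap.mulLeft ℂ (y ^ 2)
  have hμ : Function.Injective μ := fun p q h =>
    mul_left_cancel₀ (pow_ne_zero 2 prime_y.ne_zero) h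
  suffices heq : Submodule.restrictScalars ℂ
      ((Ideal.span {(x - C (a 0) * z - y) ^ 2, (x - C (a 0) * z + y) ^ 2}) ⊓
        (⨅ i ∈ Finset.Ico 1 (k + 1), Ideal.span {(x - C (a i) * z) ^ 2, y ^ 2}) ⊓ J) ⊓
      homogeneousSubmodule (Fin 3) ℂ (2 * k + 1) =
      (Submodule.restrictScalars ℂ (J ⊓ Ideal.span {x - C (a 0) * z, y}) ⊓
        homogeneousSubmodule (Fin 3) ℂ (2 * k + 1 - 2)).map μ by
    rw [hdim, hdim, heq]
    exact (Submodule.equivMapOfInjective μ hμ _).symm.finrank_eq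
  ext f
  simp only [Submodule.mem_map, Submodule.mem_inf, Submodule.restrictScalars_mem,
    Submodule.mem_iInf, mem_homogeneousSubmodule]
  constructor
  · rintro ⟨⟨⟨hfB, hfA⟩, hfJ⟩, hf⟩
    obtain ⟨g, rfl⟩ : y ∣ f := by
      refine y_dvd_of_restrictLine_eq_zero hf
        (restrictLine_eq_zero hf hinj (fun _ => 2) (fun i hi => ?_) ?_)
      · rw [hrange, Finset.mem_insert] at hi
        obtain rfl | hi := hi
        · exact sq_dvd_restrictLine_of_symmetric hfB
        · exact sq_dvd_restrictLine (hfA i hi)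
      · simp
        omega
    have hg : g.IsHomogeneous (2 * k) := isHomogeneous_of_X_mul hf
    have hgB := mem_span_of_y_mul_mem_symmetric hfB
    have hg0 : restrictLine g = 0 := by
      refine restrictLine_eq_zero hg hinj (fun i => if i = 0 then 1 else 2) (fun i hi => ?_) ?_
      · rw [hrange, Finset.mem_insert] at hi
        obtain rfl | hi := hi
        · simpa using dvd_restrictLine hgB
        · have : i ≠ 0 := by
            rw [Finset.mem_Ico] at hi
            omega
          simpa [this] using sq_dvd_restrictLine_of_y_mul (hfA i hi)
      · rw [Finset.sum_range_succ']
        simp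
        omega
    rcases k with _ | k
    · rw [eq_zero_of_isHomogeneous_zero hg hg0]
      exact ⟨0, ⟨⟨J.zero_mem, Ideal.zero_mem _⟩, isHomogeneous_zero _ _ _⟩, by simp⟩
    · obtain ⟨h, rfl⟩ := y_dvd_of_restrictLine_eq_zero hg hg0
      exact ⟨h, ⟨⟨hJ _ (hJ _ hfJ), mem_span_of_y_mul_mem hgB⟩,
        isHomogeneous_of_X_mul hg⟩, show y ^ 2 * h = _ by ring⟩
  · rintro ⟨h, ⟨⟨hhJ, hhB⟩, hh⟩, rfl⟩
    refine ⟨⟨⟨y_sq_mul_mem_symmetric hhB, fun i _ => ?_⟩, J.mul_mem_left _ hhJ⟩, ?_⟩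
    · exact Ideal.mul_mem_right _ _ (Ideal.subset_span (by simp))
    · rcases k with _ | k
      · rw [eq_zero_of_mem_span_of_isHomogeneous_zero hh hhB, map_zero]
        exact isHomogeneous_zero _ _ _
      · rw [show 2 * (k + 1) + 1 = 1 * 2 + (2 * (k + 1) + 1 - 2) by omega]
        exact ((isHomogeneous_X ℂ (1 : Fin 3)).pow 2).mul hh
end

section
/- Let d ≥ 6 be even and set k = d/2. Fix α ∈ ℂ with α ∉ {0, −1}, pairwise distinct nonzero a₁, …, a_{k−2}, b ∈ ℂ, and pairwise distinct nonzero c₁, …, c_{k−2}, e ∈ ℂ. In S = ℂ[x,y,z] define: Y = (x²y − xy², x³ − y³, y⁴); A_i = ((x − a_i z)², y²) for 1 ≤ i ≤ k−2; B = ((x − bz − y)², (x − bz + y)²); C_j = ((y − c_j z)², (x + αy)²) for 1 ≤ j ≤ k−2; D = ((y − ez − (x+αy))², (y − ez + (x+αy))²). Let J ⊆ S be a homogeneous ideal with J : (y) = J and J : (x + αy) = J. Then dim_ℂ ( Y ∩ A₁ ∩ ⋯ ∩ A_{k−2} ∩ B ∩ C₁ ∩ ⋯ ∩ C_{k−2}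 ∩ D ∩ J )_d = dim_ℂ ( J ∩ (x − bz, y) ∩ (x + αy, y − ez) )_{d−4}. -/
open MvPolynomial

local notation "x" => (X 0 : MvPolynomial (Fin 3) ℂ)
local notation "y" => (X 1 : MvPolynomial (Fin 3) ℂ)
local notation "z" => (X 2 : MvPolynomial (Fin 3) ℂ)

/-- Restriction of polynomials to the line parametrised by `[p X : q X : Z]`, as polynomials in
`X` with coefficients in `ℂ[Z]`. -/
noncomputable def lineRestriction (p q : ℂ) :
    MvPolynomial (Fin 3) ℂ →ₐ[ℂ] Polynomial (Polynomial ℂ) :=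
  aeval ![Polynomial.C (Polynomial.C p) * Polynomial.X,
    Polynomial.C (Polynomial.C q) * Polynomial.X, Polynomial.C Polynomial.X]

theorem lineRestriction_x (p q : ℂ) :
    lineRestriction p q x = Polynomial.C (Polynomial.C p) * Polynomial.X := by
  simp [lineRestriction]

theorem lineRestriction_y (p q : ℂ) :
    lineRestriction p q y = Polynomial.C (Polynomial.C q) * Polynomial.X := by
  simp [lineRestriction]

theorem lineRestriction_z (p q : ℂ) :
    lineRestriction p q z = Polynomial.C Polynomial.X := by
  simp [lineRestriction]

theorem lineRestriction_C (p q c : ℂ) :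
    lineRestriction p q (C c) = Polynomial.C (Polynomial.C c) :=
  (lineRestriction p q).commutes c

theorem natDegree_lineRestriction_le (p q : ℂ) (f : MvPolynomial (Fin 3) ℂ) :
    (lineRestriction p q f).natDegree ≤ f.totalDegree := by
  have h := aeval_natDegree_le (map Polynomial.C f) (m := f.totalDegree) (n := 1)
    (Finset.sup_mono (support_map_subset _ _))
    ![Polynomial.C (Polynomial.C p) * Polynomial.X,
      Polynomial.C (Polynomial.C q) * Polynomial.X, Polynomial.C Polynomial.X] (by
      intro i
      fin_cases i
      · simpa using Polynomial.natDegree_C_mul_X_pow_le _ 1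
      · simpa using Polynomial.natDegree_C_mul_X_pow_le _ 1
      · simp)
  rw [mul_one, aeval_def, eval₂_map] at h
  exact h

/-- `φ` is the restriction to the line `t = 0`, on which the linear form `s` is the coordinate
vanishing at `[0 : 0 : 1]`. -/
structure IsLineRestriction (φ : MvPolynomial (Fin 3) ℂ →ₐ[ℂ] Polynomial (Polynomial ℂ))
    (t s : MvPolynomial (Fin 3) ℂ) : Prop where
  surjective : Function.Surjective φ
  eq_zero_iff : ∀ f, φ f = 0 ↔ t ∣ f
  map_coord : φ s = Polynomial.X
  natDegree_le : ∀ f, (φ f).natDegree ≤ f.totalDegree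

theorem isLineRestriction_lineRestriction {p q : ℂ} {t s u : MvPolynomial (Fin 3) ℂ}
    (hs : lineRestriction p q s = Polynomial.X) (hu : lineRestriction p q u = Polynomial.X)
    (ht : lineRestriction p q t = 0) (hx : t ∣ x - C p * u) (hy : t ∣ y - C q * u) :
    IsLineRestriction (lineRestriction p q) t s := by
  let ψ : Polynomial (Polynomial ℂ) →+* MvPolynomial (Fin 3) ℂ :=
    Polynomial.eval₂RingHom (Polynomial.eval₂RingHom C z) u
  have hφψ : (lineRestriction p q : _ →+* _).comp ψ = RingHom.id _ := by
    ext <;> simp [ψ, hu, lineRestriction_z]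
  have hψφ : ((Ideal.Quotient.mk (Ideal.span {t})).comp ψ).comp (lineRestriction p q : _ →+* _) =
      Ideal.Quotient.mk (Ideal.span {t}) := by
    apply MvPolynomial.ringHom_ext
    · intro c
      simp [ψ]
    · intro i
      fin_cases i
      · simp only [RingHom.comp_apply]
        rw [Eq.comm, Ideal.Quotient.eq, Ideal.mem_span_singleton]
        simpa [ψ, lineRestriction_x] using hx
      · simp only [RingHom.comp_apply]
        rw [Eq.comm, Ideal.Quotient.eq, Ideal.mem_span_singleton]
        simpa [ψ, lineRestriction_y] using hy
      · simp [ψ, lineRestriction_z]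
  refine ⟨fun f ↦ ⟨ψ f, RingHom.congr_fun hφψ f⟩, fun f ↦ ⟨fun hf ↦ ?_, ?_⟩, hs,
    natDegree_lineRestriction_le p q⟩
  · have h := RingHom.congr_fun hψφ f
    simp only [RingHom.comp_apply, RingHom.coe_coe, hf, map_zero] at h
    exact Ideal.mem_span_singleton.1 (Ideal.Quotient.eq_zero_iff_mem.1 h.symm)
  · rintro ⟨g, rfl⟩
    rw [map_mul, ht, zero_mul]

/-- A nonzero polynomial of degree at most `n` cannot vanish at distinct points to total order
greater than `n`. -/
theorem eq_zero_of_natDegree_lt_sum_multiplicity {R ι : Type*} [CommRing R] [IsDomain R]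
    {f : Polynomial R} (T : Finset ι) (r : ι → R) (hr : Set.InjOn r T) (n : ι → ℕ)
    (hdvd : ∀ i ∈ T, (Polynomial.X - Polynomial.C (r i)) ^ n i ∣ f)
    (hdeg : f.natDegree < ∑ i ∈ T, n i) : f = 0 := by
  classical
  by_contra hf
  refine hdeg.not_ge ?_
  calc ∑ i ∈ T, n i ≤ ∑ i ∈ T, f.roots.count (r i) :=
        Finset.sum_le_sum fun i hi ↦ by
          rw [Polynomial.count_roots]
          exact (Polynomial.le_rootMultiplicity_iff hf).2 (hdvd i hi)
    _ = ∑ w ∈ T.image r, f.roots.count w := by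
        rw [Finset.sum_image hr]
    _ ≤ ∑ w ∈ f.roots.toFinset, f.roots.count w := by
        refine Finset.sum_le_sum_of_ne_zero fun w _ hw ↦ ?_
        exact Multiset.mem_toFinset.2 (Multiset.count_ne_zero.1 hw)
    _ = f.roots.card := Multiset.toFinset_sum_count_eq _
    _ ≤ f.natDegree := Polynomial.card_roots' f

theorem eq_zero_of_dvd_of_natDegree_lt {f : Polynomial (Polynomial ℂ)} {n u v : ℕ}
    {a : ℕ → ℂ} {b : ℂ} (ha0 : ∀ i < n, a i ≠ 0) (hb0 : b ≠ 0)
    (ha : ∀ i < n, ∀ j < n, a i = a j → i = j) (hab : ∀ i < n, a i ≠ b)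
    (hX : Polynomial.X ^ u ∣ f)
    (hA : ∀ i < n, (Polynomial.X - Polynomial.C (Polynomial.C (a i) * Polynomial.X)) ^ 2 ∣ f)
    (hB : (Polynomial.X - Polynomial.C (Polynomial.C b * Polynomial.X)) ^ v ∣ f)
    (hdeg : f.natDegree < 2 * n + u + v) : f = 0 := by
  let r : Option (Option (Fin n)) → ℂ := fun o ↦ o.elim 0 fun o ↦ o.elim b fun i ↦ a i
  have hr : Function.Injective r := by
    rintro (_ | _ | i) (_ | _ | j) h
    · rfl
    · exact absurd h.symm hb0
    · exact absurd h.symm (ha0 j j.2)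
    · exact absurd h hb0
    · rfl
    · exact absurd h.symm (hab j j.2)
    · exact absurd h (ha0 i i.2)
    · exact absurd h (hab i i.2)
    · rw [Fin.ext (ha i i.2 j j.2 h)]
  refine eq_zero_of_natDegree_lt_sum_multiplicity Finset.univ
    (fun o ↦ Polynomial.C (r o) * Polynomial.X) (fun o _ o' _ h ↦ hr ?_)
    (fun o ↦ o.elim u fun o ↦ o.elim v fun _ ↦ 2) ?_ ?_
  · exact Polynomial.C_injective (mul_right_cancel₀ Polynomial.X_ne_zero h)
  · rintro (_ | _ | i) -
    · simpa [r] using hX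
    · exact hB
    · exact hA i i.2
  · simp only [Fintype.sum_option, Option.elim, Finset.sum_const, Finset.card_univ,
      Fintype.card_fin, smul_eq_mul]
    omega

theorem MvPolynomial.IsHomogeneous.of_mul_left {σ R : Type*} [CommRing R] [IsDomain R]
    {f g : MvPolynomial σ R} {m n : ℕ} (hf : f.IsHomogeneous m) (hf0 : f ≠ 0)
    (hfg : (f * g).IsHomogeneous (m + n)) : g.IsHomogeneous n := by
  let : GradedAlgebra (homogeneousSubmodule σ R) := gradedAlgebra
  have h := DirectSum.coe_decompose_mul_add_of_left_mem (homogeneousSubmodule σ R)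
    (i := m) (j := n) (b := g) hf
  rw [DirectSum.decompose_of_mem_same _ hfg] at h
  rw [mul_left_cancel₀ hf0 h]
  exact (DirectSum.decompose (homogeneousSubmodule σ R) g n).2

namespace IsLineRestriction

variable {φ : MvPolynomial (Fin 3) ℂ →ₐ[ℂ] Polynomial (Polynomial ℂ)}
  {t s : MvPolynomial (Fin 3) ℂ}

theorem map_self (h : IsLineRestriction φ t s) : φ t = 0 := (h.eq_zero_iff t).2 dvd_rfl

theorem mem_span_pair_iff (h : IsLineRestriction φ t s) {L f : MvPolynomial (Fin 3) ℂ} :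
    f ∈ Ideal.span {L, t} ↔ φ L ∣ φ f := by
  rw [Ideal.mem_span_pair]
  constructor
  · rintro ⟨u, v, rfl⟩
    simp [h.map_self]
  · rintro ⟨w, hw⟩
    obtain ⟨w, rfl⟩ := h.surjective w
    obtain ⟨v, hv⟩ := (h.eq_zero_iff (f - w * L)).1 (by rw [map_sub, map_mul, hw]; ring)
    exact ⟨w, v, by linear_combination -hv⟩

theorem sq_dvd_of_mem_span (h : IsLineRestriction φ t s) {L f : MvPolynomial (Fin 3) ℂ}
    (hf : f ∈ Ideal.span {L ^ 2, t ^ 2}) : φ L ^ 2 ∣ φ f := by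
  obtain ⟨u, v, rfl⟩ := Ideal.mem_span_pair.1 hf
  simp [h.map_self]

theorem sq_dvd_of_mem_span_sub_add (h : IsLineRestriction φ t s) {L f : MvPolynomial (Fin 3) ℂ}
    (hf : f ∈ Ideal.span {(L - t) ^ 2, (L + t) ^ 2}) : φ L ^ 2 ∣ φ f := by
  obtain ⟨u, v, rfl⟩ := Ideal.mem_span_pair.1 hf
  exact ⟨φ u + φ v, by simp [h.map_self]; ring⟩

theorem sq_dvd_of_mul_mem_span (h : IsLineRestriction φ t s) (ht : t ≠ 0)
    {L f : MvPolynomial (Fin 3) ℂ} (hL : φ L ≠ 0)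
    (hf : t * f ∈ Ideal.span {L ^ 2, t ^ 2}) : φ L ^ 2 ∣ φ f := by
  obtain ⟨u, v, huv⟩ := Ideal.mem_span_pair.1 hf
  have hu : φ u = 0 := by
    have := congrArg φ huv
    simpa [h.map_self, hL] using this
  obtain ⟨w, rfl⟩ := (h.eq_zero_iff u).1 hu
  have : f = w * L ^ 2 + v * t := mul_left_cancel₀ ht (by linear_combination -huv)
  simp [this, h.map_self]

theorem exists_of_mul_mem_span_sub_add (h : IsLineRestriction φ t s) (ht : t ≠ 0)
    {L f : MvPolynomial (Fin 3) ℂ} (hL : φ L ≠ 0)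
    (hf : t * f ∈ Ideal.span {(L - t) ^ 2, (L + t) ^ 2}) :
    ∃ u w, f = u * L + w * t ^ 2 := by
  obtain ⟨u, v, huv⟩ := Ideal.mem_span_pair.1 hf
  have hu : φ (u + v) = 0 := by
    have := congrArg φ huv
    simp only [map_add, map_mul, map_pow, map_sub, h.map_self, zero_mul, sub_zero, add_zero,
      ← add_mul] at this
    rw [map_add]
    exact (mul_eq_zero.1 this).resolve_right (pow_ne_zero 2 hL)
  obtain ⟨w, hw⟩ := (h.eq_zero_iff _).1 hu
  exact ⟨w * L + 2 * (v - u), w,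
    mul_left_cancel₀ ht (by linear_combination -huv + (L ^ 2 + t ^ 2) * hw)⟩

theorem dvd_of_mul_mem_span_sub_add (h : IsLineRestriction φ t s) (ht : t ≠ 0)
    {L f : MvPolynomial (Fin 3) ℂ} (hL : φ L ≠ 0)
    (hf : t * f ∈ Ideal.span {(L - t) ^ 2, (L + t) ^ 2}) : φ L ∣ φ f := by
  obtain ⟨u, w, rfl⟩ := h.exists_of_mul_mem_span_sub_add ht hL hf
  simp [h.map_self]

theorem sq_mul_mem_span_sub_add_iff (h : IsLineRestriction φ t s) (ht : t ≠ 0)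
    {L f : MvPolynomial (Fin 3) ℂ} (hL : φ L ≠ 0) :
    t ^ 2 * f ∈ Ideal.span {(L - t) ^ 2, (L + t) ^ 2} ↔ f ∈ Ideal.span {L, t} := by
  constructor
  · intro hf
    rw [pow_two t, mul_assoc] at hf
    obtain ⟨u, w, huw⟩ := h.exists_of_mul_mem_span_sub_add ht hL hf
    have hu : φ u = 0 := by
      have := congrArg φ huw
      simpa [h.map_self, hL] using this
    obtain ⟨v, rfl⟩ := (h.eq_zero_iff u).1 hu
    exact Ideal.mem_span_pair.2 ⟨v, w, mul_left_cancel₀ ht (by linear_combination -huw)⟩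
  · intro hf
    obtain ⟨u, w, rfl⟩ := Ideal.mem_span_pair.1 hf
    have h4 : (C (1 / 4) : MvPolynomial (Fin 3) ℂ) * 4 = 1 := by
      rw [← map_ofNat (C : ℂ →+* MvPolynomial (Fin 3) ℂ) 4, ← map_mul]
      norm_num
    refine Ideal.mem_span_pair.2
      ⟨C (1 / 4) * (2 * w * t - u * t + w * L), C (1 / 4) * (2 * w * t + u * t - w * L), ?_⟩
    linear_combination (u * t ^ 2 * L + w * t ^ 3) * h4

theorem dvd_of_mem (h : IsLineRestriction φ t s) {n : ℕ} {a : ℕ → ℂ} {b : ℂ}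
    (ha0 : ∀ i < n, a i ≠ 0) (hb0 : b ≠ 0)
    (ha : ∀ i < n, ∀ j < n, a i = a j → i = j) (hab : ∀ i < n, a i ≠ b)
    {L : ℕ → MvPolynomial (Fin 3) ℂ} {M f : MvPolynomial (Fin 3) ℂ}
    (hL : ∀ i, φ (L i) = Polynomial.X - Polynomial.C (Polynomial.C (a i) * Polynomial.X))
    (hM : φ M = Polynomial.X - Polynomial.C (Polynomial.C b * Polynomial.X))
    (hX : Polynomial.X ^ 3 ∣ φ f) (hA : ∀ i < n, f ∈ Ideal.span {L i ^ 2, t ^ 2})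
    (hB : f ∈ Ideal.span {(M - t) ^ 2, (M + t) ^ 2}) (hdeg : f.totalDegree < 2 * n + 5) :
    t ∣ f := by
  refine (h.eq_zero_iff f).1 (eq_zero_of_dvd_of_natDegree_lt ha0 hb0 ha hab (u := 3) (v := 2) hX
    (fun i hi ↦ ?_) ?_ ((h.natDegree_le f).trans_lt hdeg))
  · exact hL i ▸ h.sq_dvd_of_mem_span (hA i hi)
  · exact hM ▸ h.sq_dvd_of_mem_span_sub_add hB

theorem pow_dvd_of_pow_dvd_map_coord_mul (h : IsLineRestriction φ t s) {b : ℂ} (hb : b ≠ 0)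
    {f : MvPolynomial (Fin 3) ℂ} {m n : ℕ}
    (hf : (Polynomial.X - Polynomial.C (Polynomial.C b * Polynomial.X)) ^ n ∣ φ (s ^ m * f)) :
    (Polynomial.X - Polynomial.C (Polynomial.C b * Polynomial.X)) ^ n ∣ φ f := by
  have hp := Polynomial.prime_X_sub_C (Polynomial.C b * Polynomial.X)
  rw [map_mul φ, map_pow φ, h.map_coord] at hf
  refine hp.pow_dvd_of_dvd_mul_left n (fun hX ↦ ?_) hf
  have := Polynomial.dvd_iff_isRoot.1 (hp.dvd_of_dvd_pow hX)
  simp [Polynomial.IsRoot, hb] at this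

theorem dvd_of_mul_mem (h : IsLineRestriction φ t s) (ht : t ≠ 0) {n : ℕ} {a : ℕ → ℂ} {b : ℂ}
    (ha0 : ∀ i < n, a i ≠ 0) (hb0 : b ≠ 0)
    (ha : ∀ i < n, ∀ j < n, a i = a j → i = j) (hab : ∀ i < n, a i ≠ b)
    {L : ℕ → MvPolynomial (Fin 3) ℂ} {M f : MvPolynomial (Fin 3) ℂ}
    (hL : ∀ i, φ (L i) = Polynomial.X - Polynomial.C (Polynomial.C (a i) * Polynomial.X))
    (hM : φ M = Polynomial.X - Polynomial.C (Polynomial.C b * Polynomial.X))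
    (hX : Polynomial.X ^ 2 ∣ φ f) (hA : ∀ i < n, t * (s * f) ∈ Ideal.span {L i ^ 2, t ^ 2})
    (hB : t * (s * f) ∈ Ideal.span {(M - t) ^ 2, (M + t) ^ 2})
    (hdeg : f.totalDegree < 2 * n + 3) : t ∣ f := by
  refine (h.eq_zero_iff f).1 (eq_zero_of_dvd_of_natDegree_lt ha0 hb0 ha hab (u := 2) (v := 1) hX
    (fun i hi ↦ ?_) ?_ ((h.natDegree_le f).trans_lt hdeg))
  · refine h.pow_dvd_of_pow_dvd_map_coord_mul (ha0 i hi) (m := 1) ?_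
    rw [pow_one, ← hL]
    exact h.sq_dvd_of_mul_mem_span ht (hL i ▸ Polynomial.X_sub_C_ne_zero _) (hA i hi)
  · refine h.pow_dvd_of_pow_dvd_map_coord_mul hb0 (m := 1) ?_
    rw [pow_one, pow_one, ← hM]
    exact h.dvd_of_mul_mem_span_sub_add ht (hM ▸ Polynomial.X_sub_C_ne_zero _) hB

theorem sq_mul_sq_mul_mem_span_sub_add_iff (h : IsLineRestriction φ t s) (ht : t ≠ 0) {b : ℂ}
    (hb0 : b ≠ 0) {M f : MvPolynomial (Fin 3) ℂ}
    (hM : φ M = Polynomial.X - Polynomial.C (Polynomial.C b * Polynomial.X)) :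
    t ^ 2 * (s ^ 2 * f) ∈ Ideal.span {(M - t) ^ 2, (M + t) ^ 2} ↔ f ∈ Ideal.span {M, t} := by
  rw [h.sq_mul_mem_span_sub_add_iff ht (hM ▸ Polynomial.X_sub_C_ne_zero _)]
  refine ⟨fun hf ↦ ?_, fun hf ↦ Ideal.mul_mem_left _ _ hf⟩
  rw [h.mem_span_pair_iff, hM] at hf ⊢
  simpa using h.pow_dvd_of_pow_dvd_map_coord_mul hb0 (m := 2) (n := 1) (by simpa using hf)

end IsLineRestriction

theorem isLineRestriction_y (α : ℂ) :
    IsLineRestriction (lineRestriction 1 0) y (x + C α * y) := by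
  apply isLineRestriction_lineRestriction (u := x) <;>
    simp [lineRestriction_x, lineRestriction_y]

theorem isLineRestriction_x_add_C_mul_y (α : ℂ) :
    IsLineRestriction (lineRestriction (-α) 1) (x + C α * y) y := by
  have hy : lineRestriction (-α) 1 y = Polynomial.X := by simp [lineRestriction_y]
  refine isLineRestriction_lineRestriction hy hy ?_ (by simp) (by simp)
  rw [map_add, map_mul, hy, lineRestriction_x, lineRestriction_C, map_neg, map_neg]
  ring

theorem isHomogeneous_x_add_C_mul_y (α : ℂ) : (x + C α * y).IsHomogeneous 1 :=
  (isHomogeneous_X ℂ 0).add ((isHomogeneous_X ℂ 1).C_mul α)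

theorem x_add_C_mul_y_ne_zero (α : ℂ) : x + C α * y ≠ 0 := by
  intro h
  have := (isLineRestriction_y α).map_coord
  rw [h, map_zero] at this
  exact Polynomial.X_ne_zero this.symm

/-- Residuating the limit of two colliding 2-squares by two distinct lines through its support,
neither of them in its tangent directions, leaves at least a double point. -/
theorem exists_eq_of_mul_mem_span_collision {α : ℂ} (hα0 : α ≠ 0) (hα1 : α ≠ -1)
    {f : MvPolynomial (Fin 3) ℂ}
    (hf : y * ((x + C α * y) * f) ∈
      Ideal.span {x ^ 2 * y - x * y ^ 2, x ^ 3 - y ^ 3, y ^ 4}) :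
    ∃ u v w, f = u * (x + C α * y) ^ 2 + v * ((x + C α * y) * y) + w * y ^ 2 := by
  have hr := isLineRestriction_y α
  have hm := isLineRestriction_x_add_C_mul_y α
  have hy : y ≠ 0 := X_ne_zero 1
  obtain ⟨p, q, r, hpqr⟩ := Submodule.mem_span_triple.1 hf
  simp only [smul_eq_mul] at hpqr
  have hq : lineRestriction 1 0 q = 0 := by
    have := congrArg (lineRestriction 1 0) hpqr
    simpa [lineRestriction_x, lineRestriction_y] using this
  obtain ⟨q, rfl⟩ := (hr.eq_zero_iff q).1 hq
  have hpq : p * (x ^ 2 - x * y) + q * (x ^ 3 - y ^ 3) + r * y ^ 3 = (x + C α * y) * f :=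
    mul_left_cancel₀ hy (by linear_combination hpqr)
  obtain ⟨w, hw⟩ : ∃ w, lineRestriction (-α) 1 (p - y * w) = 0 := by
    have h := congrArg (lineRestriction (-α) 1) hpq
    rw [map_mul _ (x + C α * y), hm.map_self, zero_mul] at h
    simp only [map_add, map_mul, map_sub, map_pow, lineRestriction_x, lineRestriction_y,
      map_neg, map_one, one_mul] at h
    have hβ : α ^ 2 + α ≠ 0 := fun h0 ↦ by
      have : α * (α + 1) = 0 := by linear_combination h0
      rcases mul_eq_zero.1 this with h | h
      · exact hα0 h
      · exact hα1 (eq_neg_of_add_eq_zero_left h)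
    have hβ' : Polynomial.C (Polynomial.C (α ^ 2 + α)⁻¹) *
        (Polynomial.C (Polynomial.C α) ^ 2 + Polynomial.C (Polynomial.C α)) = 1 := by
      simp only [← map_pow, ← map_add, ← map_mul]
      rw [inv_mul_cancel₀ hβ, map_one, map_one]
    obtain ⟨w, hw⟩ := hm.surjective (-Polynomial.C (Polynomial.C (α ^ 2 + α)⁻¹) *
      (lineRestriction (-α) 1 q * (-Polynomial.C (Polynomial.C α) ^ 3 - 1) +
        lineRestriction (-α) 1 r))
    refine ⟨w, mul_left_cancel₀ (pow_ne_zero 2 Polynomial.X_ne_zero) (?_ :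
      Polynomial.X ^ 2 * _ = Polynomial.X ^ 2 * _)⟩
    rw [map_sub, map_mul, hw, hm.map_coord]
    linear_combination Polynomial.C (Polynomial.C (α ^ 2 + α)⁻¹) * h -
      Polynomial.X ^ 2 * lineRestriction (-α) 1 p * hβ'
  obtain ⟨v, hv⟩ := (hm.eq_zero_iff _).1 hw
  have hs : lineRestriction (-α) 1
      ((C α ^ 2 + C α) * w - (C α ^ 3 + 1) * q + r) = 0 := by
    have h := congrArg (lineRestriction (-α) 1) (show y ^ 3 * ((C α ^ 2 + C α) * w -
      (C α ^ 3 + 1) * q + r) = (x + C α * y) * (f - v * (x ^ 2 - x * y) -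
        w * y * (x - C α * y - y) - q * (x ^ 2 - x * (C α * y) + (C α * y) ^ 2)) by
      linear_combination hpq - (x ^ 2 - x * y) * hv)
    rw [map_mul, map_mul _ (x + C α * y), hm.map_self, zero_mul, map_pow, hm.map_coord] at h
    exact (mul_eq_zero.1 h).resolve_left (pow_ne_zero 3 Polynomial.X_ne_zero)
  obtain ⟨g, hg⟩ := (hm.eq_zero_iff _).1 hs
  refine ⟨v + q, w - v * (2 * C α + 1) - 3 * q * C α,
    v * (C α * (C α + 1)) - w * (2 * C α + 1) + 3 * q * C α ^ 2 + g * y,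
    mul_left_cancel₀ (x_add_C_mul_y_ne_zero α) ?_⟩
  linear_combination -hpq + (x ^ 2 - x * y) * hv + y ^ 3 * hg

theorem sq_mul_sq_mem_span_collision (α : ℂ) (f : MvPolynomial (Fin 3) ℂ) :
    y ^ 2 * ((x + C α * y) ^ 2 * f) ∈
      Ideal.span {x ^ 2 * y - x * y ^ 2, x ^ 3 - y ^ 3, y ^ 4} :=
  Submodule.mem_span_triple.2 ⟨f * (-x - 2 * C α * (x + y)), f * (y + 2 * C α * y),
    f * (1 + 2 * C α + C α ^ 2), by simp only [smul_eq_mul]; ring⟩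

/-- The Horace lemma for the even-degree inductive step: the flat limit `Y` of two
colliding 2-squares at `P = [0:0:1]`, `k-2` 2-squares of type (1.a) and one of
type (1.b) on the line `r : y = 0`, `k-2` 2-squares of type (1.a) and one of
type (1.b) on the line `m : x + αy = 0`, together with a residual scheme meeting
neither `r` nor `m`. -/
theorem stmt_5 (d k : ℕ) (hd6 : 6 ≤ d) (hdk : d = 2 * k)
    (α : ℂ) (hα0 : α ≠ 0) (hα1 : α ≠ -1)
    (a : ℕ → ℂ) (b : ℂ)
    (ha0 : ∀ i < k - 2, a i ≠ 0) (hb0 : b ≠ 0)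
    (ha : ∀ i < k - 2, ∀ j < k - 2, a i = a j → i = j)
    (hab : ∀ i < k - 2, a i ≠ b)
    (c : ℕ → ℂ) (e : ℂ)
    (hc0 : ∀ i < k - 2, c i ≠ 0) (he0 : e ≠ 0)
    (hc : ∀ i < k - 2, ∀ j < k - 2, c i = c j → i = j)
    (hce : ∀ i < k - 2, c i ≠ e)
    (J : Ideal (MvPolynomial (Fin 3) ℂ))
    (hJhom : ∀ f ∈ J, ∀ n : ℕ, homogeneousComponent n f ∈ J)
    (hJr : J.colon (Ideal.span {y}) = J)
    (hJm : J.colon (Ideal.span {x + C α * y}) = J) :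
    hdim ((Ideal.span {x ^ 2 * y - x * y ^ 2, x ^ 3 - y ^ 3, y ^ 4}) ⊓
        (⨅ i ∈ Finset.range (k - 2), Ideal.span {(x - C (a i) * z) ^ 2, y ^ 2}) ⊓
        (Ideal.span {(x - C b * z - y) ^ 2, (x - C b * z + y) ^ 2}) ⊓
        (⨅ j ∈ Finset.range (k - 2),
          Ideal.span {(y - C (c j) * z) ^ 2, (x + C α * y) ^ 2}) ⊓
        (Ideal.span {(y - C e * z - (x + C α * y)) ^ 2,
                     (y - C e * z + (x + C α * y)) ^ 2}) ⊓ J) d =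
      hdim (J ⊓ Ideal.span {x - C b * z, y} ⊓
        Ideal.span {x + C α * y, y - C e * z}) (d - 4) := by
  have hr := isLineRestriction_y α
  have hm := isLineRestriction_x_add_C_mul_y α
  have hy : y ≠ 0 := X_ne_zero 1
  have hm0 := x_add_C_mul_y_ne_zero α
  have hrL : ∀ r : ℂ, lineRestriction 1 0 (x - C r * z) =
      Polynomial.X - Polynomial.C (Polynomial.C r * Polynomial.X) := fun r ↦ by
    simp [lineRestriction_x, lineRestriction_z]
  have hmL : ∀ r : ℂ, lineRestriction (-α) 1 (y - C r * z) =
      Polynomial.X - Polynomial.C (Polynomial.C r * Polynomial.X) := fun r ↦ by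
    simp [lineRestriction_y, lineRestriction_z]
  have hJ : ∀ l f : MvPolynomial (Fin 3) ℂ, J.colon (Ideal.span {l}) = J →
      l * f ∈ J → f ∈ J := fun l f hl hf ↦ by
    rw [← hl, Ideal.mem_colon_span_singleton, mul_comm]
    exact hf
  have hhom : (y ^ 2 * (x + C α * y) ^ 2).IsHomogeneous 4 :=
    ((isHomogeneous_X ℂ 1).pow 2).mul ((isHomogeneous_x_add_C_mul_y α).pow 2)
  have hhom' : (y * (x + C α * y)).IsHomogeneous 2 :=
    (isHomogeneous_X ℂ 1).mul (isHomogeneous_x_add_C_mul_y α)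
  have hne : y ^ 2 * (x + C α * y) ^ 2 ≠ 0 := mul_ne_zero (pow_ne_zero 2 hy) (pow_ne_zero 2 hm0)
  have hinj : Function.Injective (LinearMap.mulLeft ℂ (y ^ 2 * (x + C α * y) ^ 2)) :=
    fun f g hfg ↦ mul_left_cancel₀ hne hfg
  unfold hdim
  refine Eq.trans
    (congrArg (fun U : Submodule ℂ (MvPolynomial (Fin 3) ℂ) ↦ Module.finrank ℂ U) ?_)
    (Submodule.equivMapOfInjective _ hinj _).finrank_eq.symm
  ext f
  simp only [Submodule.mem_inf, Submodule.restrictScalars_mem, Submodule.mem_iInf,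
    Finset.mem_range, mem_homogeneousSubmodule, Submodule.mem_map, LinearMap.mulLeft_apply]
  constructor
  · rintro ⟨⟨⟨⟨⟨⟨hY, hA⟩, hB⟩, hC⟩, hD⟩, hfJ⟩, hf⟩
    have hdeg := hf.totalDegree_le
    obtain ⟨f, rfl⟩ : y ∣ f := by
      refine hr.dvd_of_mem ha0 hb0 ha hab (fun i ↦ hrL (a i)) (hrL b) ?_ hA hB (by omega)
      obtain ⟨p, q, r, rfl⟩ := Submodule.mem_span_triple.1 hY
      simp [lineRestriction_x, lineRestriction_y]
    obtain ⟨f, rfl⟩ : x + C α * y ∣ f := by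
      have h : x + C α * y ∣ y * f := by
        refine hm.dvd_of_mem hc0 he0 hc hce (fun i ↦ hmL (c i)) (hmL e) ?_ hC hD (by omega)
        obtain ⟨p, q, r, hpqr⟩ := Submodule.mem_span_triple.1 hY
        rw [← hpqr]
        simp only [smul_eq_mul, map_add, map_mul, map_sub, map_pow, lineRestriction_x,
          lineRestriction_y, map_neg, map_one, one_mul]
        exact ⟨lineRestriction (-α) 1 p *
            (Polynomial.C (Polynomial.C α) ^ 2 + Polynomial.C (Polynomial.C α)) -
          lineRestriction (-α) 1 q * (Polynomial.C (Polynomial.C α) ^ 3 + 1) +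
          lineRestriction (-α) 1 r * Polynomial.X, by ring⟩
      rw [← hm.eq_zero_iff, map_mul, hm.map_coord] at h
      exact (hm.eq_zero_iff f).1 ((mul_eq_zero.1 h).resolve_left Polynomial.X_ne_zero)
    have hdeg : f.totalDegree ≤ d - 2 := by
      refine (hhom'.of_mul_left (mul_ne_zero hy hm0) ?_).totalDegree_le
      rwa [mul_assoc, show 2 + (d - 2) = d by omega]
    obtain ⟨u, v, w, huvw⟩ := exists_eq_of_mul_mem_span_collision hα0 hα1 hY
    obtain ⟨g, hg⟩ : y ∣ f := by
      refine hr.dvd_of_mul_mem hy ha0 hb0 ha hab (fun i ↦ hrL (a i)) (hrL b) ?_ hA hB (by omega)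
      rw [huvw]
      simp [hr.map_self, hr.map_coord]
    obtain ⟨g, rfl⟩ : x + C α * y ∣ g := by
      have h : x + C α * y ∣ f := by
        rw [mul_left_comm] at hC hD
        refine hm.dvd_of_mul_mem hm0 hc0 he0 hc hce (fun i ↦ hmL (c i)) (hmL e) ?_ hC hD
          (by omega)
        rw [huvw]
        simp [hm.map_self, hm.map_coord]
      rw [hg, ← hm.eq_zero_iff, map_mul, hm.map_coord] at h
      exact (hm.eq_zero_iff g).1 ((mul_eq_zero.1 h).resolve_left Polynomial.X_ne_zero)
    subst hg
    have hfg : y * ((x + C α * y) * (y * ((x + C α * y) * g))) =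
        y ^ 2 * ((x + C α * y) ^ 2 * g) := by ring
    have hfg' : y * ((x + C α * y) * (y * ((x + C α * y) * g))) =
        (x + C α * y) ^ 2 * (y ^ 2 * g) := by ring
    refine ⟨g, ⟨⟨⟨?_, ?_⟩, ?_⟩, ?_⟩, by ring⟩
    · exact hJ _ _ hJm (hJ _ _ hJr (hJ _ _ hJm (hJ _ _ hJr hfJ)))
    · rw [hfg] at hB
      exact (hr.sq_mul_sq_mul_mem_span_sub_add_iff hy hb0 (hrL b)).1 hB
    · rw [hfg'] at hD
      rw [Set.pair_comm]
      exact (hm.sq_mul_sq_mul_mem_span_sub_add_iff hm0 he0 (hmL e)).1 hD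
    · refine hhom.of_mul_left hne ?_
      rwa [mul_assoc, ← hfg, show 4 + (d - 4) = d by omega]
  · rintro ⟨g, ⟨⟨⟨hgJ, hgB⟩, hgD⟩, hg⟩, rfl⟩
    have hcomm : y ^ 2 * ((x + C α * y) ^ 2 * g) = (x + C α * y) ^ 2 * (y ^ 2 * g) :=
      mul_left_comm _ _ _
    refine ⟨⟨⟨⟨⟨⟨?_, fun i _ ↦ ?_⟩, ?_⟩, fun i _ ↦ ?_⟩, ?_⟩, Ideal.mul_mem_left _ _ hgJ⟩, ?_⟩
    · rw [mul_assoc]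
      exact sq_mul_sq_mem_span_collision α g
    · rw [mul_assoc]
      exact Ideal.mul_mem_right _ _ (Ideal.subset_span (by simp))
    · rw [mul_assoc]
      exact (hr.sq_mul_sq_mul_mem_span_sub_add_iff hy hb0 (hrL b)).2 hgB
    · rw [mul_assoc, hcomm]
      exact Ideal.mul_mem_right _ _ (Ideal.subset_span (by simp))
    · rw [mul_assoc, hcomm]
      rw [Set.pair_comm] at hgD
      exact (hm.sq_mul_sq_mul_mem_span_sub_add_iff hm0 he0 (hmL e)).2 hgD
    · simpa [show 4 + (d - 4) = d by omega] using hhom.mul hg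
end
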